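/- arXiv:2202.01632 — 4 statements merged into one kernel-verified Lean document; each statement's English description precedes it below -/
import Mathlib

section
/- Define Bad(λ,k,i) = {x ∈ Ω^ℕ : |μ^k({ω : M_k^x((0,λ])(ω) = i}) − e^{−λ}λ^i/i!| > 2/k}, L_k = {p/q : p,q positive integers, q ≤ k, p/q < k}, J_k = {0,…,b^k−1}, and O_k = ∪_{λ∈L_k} ∪_{i∈J_k} Bad(λ,k,i). Then for every k ≥ 24, μ^ℕ(O_k) ≤ 2·b^k·k^3·exp(−2·b^k/k^5); consequently Σ_{k≥1} μ^ℕ(O_k) < ∞. -/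
open MeasureTheory Filter

/-- The uniform product measure μ^k on Ω^k, Ω = Fin b: normalized counting measure. -/
noncomputable def muK (b k : ℕ) : Measure (Fin k → Fin b) :=
  ((b : ENNReal) ^ k)⁻¹ • Measure.count

/-- ν is the product measure μ^ℕ of uniform measures on Ω = Fin b over Ω^ℕ:
every cylinder of length n has measure b^{-n}. -/
def IsUnifProductMeasure (b : ℕ) (ν : Measure (ℕ → Fin b)) : Prop :=
  ∀ (n : ℕ) (w : Fin n → Fin b),
    ν {x | ∀ t : Fin n, x (t : ℕ) = w t} = ((b : ENNReal)⁻¹) ^ n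

/-- The word w (of length k) occurs in x at position j (positions numbered from 1):
I_j(x,w) = 1. -/
def OccursAt {b k : ℕ} (x : ℕ → Fin b) (j : ℕ) (w : Fin k → Fin b) : Prop :=
  ∀ t : Fin k, x (j - 1 + (t : ℕ)) = w t

instance {b k : ℕ} (x : ℕ → Fin b) (j : ℕ) (w : Fin k → Fin b) :
    Decidable (OccursAt x j w) := by unfold OccursAt; infer_instance

/-- M_k^x(S)(w) = Σ_{j ∈ ℕ ∩ b^k S} I_j(x,w): the number of positive integers j with
j/b^k ∈ S at which w occurs in x. -/
noncomputable def Mx (b k : ℕ) (S : Set ℝ) (x : ℕ → Fin b) (w : Fin k → Fin b) : ℕ :=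
  {j : ℕ | 1 ≤ j ∧ ((j : ℝ) / (b : ℝ) ^ k) ∈ S ∧ OccursAt x j w}.ncard

/-- Z^λ_{i,k}(x): proportion of words of length k occurring exactly i times
among positions 1 ≤ j ≤ λ b^k of x. -/
noncomputable def Z (b k i : ℕ) (lam : ℝ) (x : ℕ → Fin b) : ℝ :=
  ((Finset.univ.filter (fun w : Fin k → Fin b =>
      ((Finset.Icc 1 ⌊lam * (b : ℝ) ^ k⌋₊).filter (fun j => OccursAt x j w)).card = i)).card : ℝ)
    / (b : ℝ) ^ k

/-- x is λ-Poisson generic. -/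
def LamPoissonGeneric (b : ℕ) (lam : ℝ) (x : ℕ → Fin b) : Prop :=
  ∀ i : ℕ, Tendsto (fun k : ℕ => Z b k i lam x) atTop
    (nhds (Real.exp (-lam) * lam ^ i / (Nat.factorial i : ℝ)))

/-- x is Poisson generic. -/
def PoissonGeneric (b : ℕ) (x : ℕ → Fin b) : Prop :=
  ∀ lam : ℝ, 0 < lam → LamPoissonGeneric b lam x

/-- S ⊆ [0,∞) is a finite union of pairwise disjoint intervals with rational endpoints. -/
def IsFinRatIntervalUnion (S : Set ℝ) : Prop :=
  ∃ (n : ℕ) (p q : Fin n → ℚ), (∀ m, 0 ≤ p m) ∧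
    (Pairwise fun m l : Fin n =>
      Disjoint (Set.Ioo ((p m : ℝ)) ((q m : ℝ))) (Set.Ioo ((p l : ℝ)) ((q l : ℝ)))) ∧
    S = ⋃ m, Set.Ioo ((p m : ℝ)) ((q m : ℝ))

/-- Total variation distance between two laws on ℕ (given as set functions). -/
noncomputable def dTV (P Q : Set ℕ → ℝ) : ℝ := ⨆ A : Set ℕ, |P A - Q A|

/-- The law on ℕ of M_k(S) under μ^ℕ × μ^k. -/
noncomputable def lawM (b k : ℕ) (ν : Measure (ℕ → Fin b)) (S : Set ℝ) (A : Set ℕ) : ℝ :=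
  ((ν.prod (muK b k)) {p : (ℕ → Fin b) × (Fin k → Fin b) | Mx b k S p.1 p.2 ∈ A}).toReal

/-- The law on ℕ of M_k^x(S) under μ^k. -/
noncomputable def lawMx (b k : ℕ) (x : ℕ → Fin b) (S : Set ℝ) (A : Set ℕ) : ℝ :=
  ((muK b k) {w : Fin k → Fin b | Mx b k S x w ∈ A}).toReal

/-- The Poisson law with mean λ, as a set function on ℕ. -/
noncomputable def poissonLaw (lam : ℝ) (A : Set ℕ) : ℝ :=
  ∑' i : A, Real.exp (-lam) * lam ^ (i : ℕ) / (Nat.factorial (i : ℕ) : ℝ)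

/-- Bad(λ,k,i): the x whose empirical count of words occurring i times among the
first λ b^k positions differs from the Poisson(λ) mass at i by more than 2/k. -/
def BadSet (b k i : ℕ) (lam : ℝ) : Set (ℕ → Fin b) :=
  {x | 2 / (k : ℝ) <
    |((muK b k) {w : Fin k → Fin b | Mx b k (Set.Ioc 0 lam) x w = i}).toReal
      - Real.exp (-lam) * lam ^ i / (Nat.factorial i : ℝ)|}

/-- L_k = {p/q : p,q positive integers, q ≤ k, p/q < k}. -/
def Lset (k : ℕ) : Set ℝ :=
  {r : ℝ | ∃ p q : ℕ, 1 ≤ p ∧ 1 ≤ q ∧ q ≤ k ∧ r = (p : ℝ) / (q : ℝ) ∧ r < (k : ℝ)}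

/-- O_k = ∪_{λ ∈ L_k} ∪_{i < b^k} Bad(λ,k,i). -/
def Oset (b k : ℕ) : Set (ℕ → Fin b) :=
  ⋃ lam ∈ Lset k, ⋃ i ∈ Finset.range (b ^ k), BadSet b k i lam

/-- x is λ-Poisson generic (formulated via the measures μ^k of the level sets of M_k^x). -/
def LamPoissonGenericM (b : ℕ) (lam : ℝ) (x : ℕ → Fin b) : Prop :=
  ∀ i : ℕ, Tendsto (fun k : ℕ =>
      ((muK b k) {w : Fin k → Fin b | Mx b k (Set.Ioc 0 lam) x w = i}).toReal)
    atTop (nhds (Real.exp (-lam) * lam ^ i / (Nat.factorial i : ℝ)))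

/-- x is Poisson generic (formulated via the measures μ^k of the level sets of M_k^x). -/
def PoissonGenericM (b : ℕ) (x : ℕ → Fin b) : Prop :=
  ∀ lam : ℝ, 0 < lam → LamPoissonGenericM b lam x


open scoped BigOperators

/-! ### Concentration for functions with bounded differences -/

/-- Hoeffding's lemma for the uniform distribution on a finite type. -/
lemma expect_exp_centered_le {α : Type*} [Fintype α] [Nonempty α] (f : α → ℝ) {c : ℝ}
    (hf : ∀ a a', f a' - f a ≤ c) (s : ℝ) :
    𝔼 a, Real.exp (s * (f a - 𝔼 a', f a')) ≤ Real.exp (s ^ 2 * c ^ 2 / 8) := by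
  classical
  let _ : MeasurableSpace α := ⊤
  obtain ⟨a₀, ha₀⟩ := Finite.exists_min f
  have hint : ∀ g : α → ℝ,
      ∫ a, g a ∂(PMF.uniformOfFintype α).toMeasure = 𝔼 a, g a := fun g => by
    rw [PMF.integral_eq_sum, Fintype.expect_eq_sum_div_card, Finset.sum_div]
    exact Finset.sum_congr rfl fun a _ => by simp [div_eq_inv_mul]
  have hsub := (ProbabilityTheory.hasSubgaussianMGF_of_mem_Icc
    (μ := (PMF.uniformOfFintype α).toMeasure) (X := f) (a := f a₀) (b := f a₀ + c)
    (measurable_from_top).aemeasurable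
    (MeasureTheory.ae_of_all _ fun a => ⟨ha₀ a, by linarith [hf a₀ a]⟩)).mgf_le s
  rw [ProbabilityTheory.mgf, hint, hint] at hsub
  refine hsub.trans (Real.exp_le_exp.2 (le_of_eq ?_))
  simp only [add_sub_cancel_left, NNReal.coe_pow, NNReal.coe_div, coe_nnnorm, Real.norm_eq_abs,
    div_pow, sq_abs, NNReal.coe_ofNat]
  ring

lemma expect_fin_cons {α : Type*} [Fintype α] {N : ℕ} (f : (Fin (N + 1) → α) → ℝ) :
    𝔼 x, f x = 𝔼 y : Fin N → α, 𝔼 a, f (Fin.cons a y) := by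
  rw [Finset.expect_comm, ← Finset.expect_product', Finset.univ_product_univ]
  exact (Fintype.expect_equiv (Fin.consEquiv fun _ : Fin (N + 1) => α) _ _ fun _ => rfl).symm

lemma expect_exp_le_of_bounded_differences {α : Type*} [Fintype α] [Nonempty α]
    {c : ℝ} (s : ℝ) : ∀ (N : ℕ) (f : (Fin N → α) → ℝ),
    (∀ x m a, |f (Function.update x m a) - f x| ≤ c) →
    𝔼 x, Real.exp (s * (f x - 𝔼 y, f y)) ≤ Real.exp (N * (s ^ 2 * c ^ 2 / 8))
  | 0, f, _ => by
    simp [Subsingleton.elim _ (default : Fin 0 → α)]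
  | N + 1, f, hf => by
    set F : (Fin N → α) → ℝ := fun y => 𝔼 a, f (Fin.cons a y) with hF
    have hFdiff : ∀ y m a, |F (Function.update y m a) - F y| ≤ c := fun y m a => by
      rw [hF]
      simp only [← Finset.expect_sub_distrib]
      refine (Finset.abs_expect_le _ _).trans ?_
      refine (Finset.expect_le_expect (g := fun _ => c) fun a' _ => ?_).trans_eq
        (Fintype.expect_const c)
      rw [Fin.cons_update]
      exact hf _ _ _
    have hmean : 𝔼 x, f x = 𝔼 y, F y := expect_fin_cons f
    rw [hmean, expect_fin_cons]
    have hstep : ∀ y : Fin N → α,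
        𝔼 a, Real.exp (s * (f (Fin.cons a y) - 𝔼 y, F y)) ≤
          Real.exp (s ^ 2 * c ^ 2 / 8) * Real.exp (s * (F y - 𝔼 y, F y)) := fun y => by
      have h := expect_exp_centered_le (fun a => f (Fin.cons a y)) (c := c) (fun a a' => by
        have h := hf (Fin.cons a y) 0 a'
        rw [Fin.update_cons_zero] at h
        exact (le_abs_self _).trans h) s
      calc _ = (𝔼 a, Real.exp (s * (f (Fin.cons a y) - F y))) *
            Real.exp (s * (F y - 𝔼 y, F y)) := by
            rw [Finset.expect_mul]
            refine Finset.expect_congr rfl fun a _ => ?_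
            rw [← Real.exp_add]
            ring_nf
        _ ≤ _ := by gcongr
    calc _ ≤ 𝔼 y, Real.exp (s ^ 2 * c ^ 2 / 8) * Real.exp (s * (F y - 𝔼 y, F y)) :=
          Finset.expect_le_expect fun y _ => hstep y
      _ ≤ Real.exp (s ^ 2 * c ^ 2 / 8) * Real.exp (N * (s ^ 2 * c ^ 2 / 8)) := by
          rw [← Finset.mul_expect]
          gcongr
          exact expect_exp_le_of_bounded_differences s N F hFdiff
      _ = _ := by
          rw [← Real.exp_add]
          push_cast
          ring_nf

/-- McDiarmid's inequality, upper tail, for the uniform distribution. -/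
lemma card_upper_tail_le_of_bounded_differences {α : Type*} [Fintype α] [Nonempty α]
    {c t : ℝ} (hc : 0 < c) (ht : 0 ≤ t) {N : ℕ} (hN : 0 < N) (f : (Fin N → α) → ℝ)
    (hf : ∀ x m a, |f (Function.update x m a) - f x| ≤ c) :
    ((Finset.univ.filter fun x => t ≤ f x - 𝔼 y, f y).card : ℝ) ≤
      Fintype.card (Fin N → α) * Real.exp (-2 * t ^ 2 / (N * c ^ 2)) := by
  have hN' : (0 : ℝ) < N := by exact_mod_cast hN
  set s : ℝ := 4 * t / (N * c ^ 2) with hs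
  have hs0 : 0 ≤ s := by positivity
  have h := expect_exp_le_of_bounded_differences s N f hf
  rw [Fintype.expect_eq_sum_div_card, div_le_iff₀ (by positivity)] at h
  have h2 : ((Finset.univ.filter fun x => t ≤ f x - 𝔼 y, f y).card : ℝ) * Real.exp (s * t) ≤
      ∑ x, Real.exp (s * (f x - 𝔼 y, f y)) := by
    rw [← nsmul_eq_mul, ← Finset.sum_const]
    refine (Finset.sum_le_sum fun x hx => ?_).trans
      (Finset.sum_le_sum_of_subset_of_nonneg (Finset.filter_subset _ _)
        fun x _ _ => (Real.exp_pos _).le)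
    have := (Finset.mem_filter.1 hx).2
    gcongr
  have h3 := h2.trans h
  rw [← le_div_iff₀ (Real.exp_pos _), mul_comm, mul_div_assoc, ← Real.exp_sub] at h3
  refine h3.trans_eq ?_
  congr 2
  rw [hs]
  field_simp
  ring

/-- McDiarmid's inequality for the uniform distribution. -/
lemma card_abs_tail_le_of_bounded_differences {α : Type*} [Fintype α] [Nonempty α]
    {c t : ℝ} (hc : 0 < c) (ht : 0 ≤ t) {N : ℕ} (hN : 0 < N) (f : (Fin N → α) → ℝ)
    (hf : ∀ x m a, |f (Function.update x m a) - f x| ≤ c) :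
    ((Finset.univ.filter fun x => t ≤ |f x - 𝔼 y, f y|).card : ℝ) ≤
      2 * Fintype.card (Fin N → α) * Real.exp (-2 * t ^ 2 / (N * c ^ 2)) := by
  classical
  have h1 := card_upper_tail_le_of_bounded_differences hc ht hN f hf
  have h2 := card_upper_tail_le_of_bounded_differences hc ht hN (fun x => -f x) (fun x m a => by
    rw [neg_sub_neg, abs_sub_comm]
    exact hf x m a)
  have hsub : (Finset.univ.filter fun x => t ≤ |f x - 𝔼 y, f y|) ⊆
      (Finset.univ.filter fun x => t ≤ f x - 𝔼 y, f y) ∪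
        (Finset.univ.filter fun x => t ≤ -f x - 𝔼 y, -f y) := fun x hx => by
    simp only [Finset.mem_union, Finset.mem_filter, Finset.mem_univ, true_and,
      Finset.expect_neg_distrib] at hx ⊢
    rcases le_abs.1 hx with h | h
    · exact Or.inl h
    · right
      linarith
  have h3 : ((Finset.univ.filter fun x => t ≤ |f x - 𝔼 y, f y|).card : ℝ) ≤ _ :=
    Nat.cast_le.2 ((Finset.card_le_card hsub).trans (Finset.card_union_le _ _))
  push_cast at h3
  linarith

/-! ### Poisson weights -/

/-- The mass that the Poisson law of mean `t` gives to `i - s` (zero if `i < s`). -/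
noncomputable def poissonWeight (t : ℝ) (i s : ℕ) : ℝ :=
  if s ≤ i then Real.exp (-t) * t ^ (i - s) / (Nat.factorial (i - s) : ℝ) else 0

lemma poissonWeight_nonneg {t : ℝ} (ht : 0 ≤ t) (i s : ℕ) : 0 ≤ poissonWeight t i s := by
  unfold poissonWeight
  split_ifs <;> positivity

lemma poissonWeight_le_one {t : ℝ} (ht : 0 ≤ t) (i s : ℕ) : poissonWeight t i s ≤ 1 := by
  unfold poissonWeight
  split_ifs
  · rw [mul_div_assoc, Real.exp_neg, inv_mul_le_iff₀ (Real.exp_pos t), mul_one]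
    exact Real.pow_div_factorial_le_exp t ht _
  · exact zero_le_one

lemma abs_poissonWeight_sub_le_one {t u : ℝ} (ht : 0 ≤ t) (hu : 0 ≤ u) (i s i' s' : ℕ) :
    |poissonWeight t i s - poissonWeight u i' s'| ≤ 1 := by
  rw [abs_le]
  constructor <;> linarith [poissonWeight_nonneg ht i s, poissonWeight_le_one ht i s,
    poissonWeight_nonneg hu i' s', poissonWeight_le_one hu i' s']

lemma poissonWeight_zero (i s : ℕ) : poissonWeight 0 i s = if s = i then 1 else 0 := by
  unfold poissonWeight
  rcases lt_trichotomy s i with h | h | h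
  · simp [h.le, h.ne, (Nat.sub_pos_of_lt h).ne']
  · simp [h]
  · simp [h.not_ge, h.ne']

lemma hasDerivAt_poissonWeight (t : ℝ) (i s : ℕ) :
    HasDerivAt (fun u => poissonWeight u i s)
      (poissonWeight t i (s + 1) - poissonWeight t i s) t := by
  unfold poissonWeight
  rcases lt_trichotomy s i with h | h | h
  · obtain ⟨m, rfl⟩ := Nat.exists_eq_add_of_lt h
    have h1 : s + m + 1 - s = m + 1 := by omega
    have h2 : s + m + 1 - (s + 1) = m := by omega
    have h3 : s + 1 ≤ s + m + 1 := by omega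
    simp only [h.le, h3, if_true, h1, h2]
    have hd := (((hasDerivAt_id t).neg.exp).mul (hasDerivAt_pow (m + 1) t)).div_const
      ((Nat.factorial (m + 1) : ℕ) : ℝ)
    refine hd.congr_deriv ?_
    have : (Nat.factorial m : ℝ) ≠ 0 := by positivity
    rw [Nat.factorial_succ]
    simp only [Pi.neg_apply, id, Nat.cast_mul]
    field_simp
    push_cast
    ring
  · subst h
    simpa using (hasDerivAt_id t).neg.exp
  · simpa [h.not_ge, (Nat.lt_succ_of_lt h).not_ge] using hasDerivAt_const t (0 : ℝ)

lemma abs_poissonWeight_sub_le {t u : ℝ} (ht : 0 ≤ t) (hu : 0 ≤ u) (i s : ℕ) :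
    |poissonWeight u i s - poissonWeight t i s| ≤ |u - t| := by
  have h := (convex_Ici (0 : ℝ)).norm_image_sub_le_of_norm_hasDerivWithin_le (C := 1)
    (f := fun u => poissonWeight u i s)
    (fun v _ => (hasDerivAt_poissonWeight v i s).hasDerivWithinAt)
    (fun v hv => abs_poissonWeight_sub_le_one hv hv i (s + 1) i s) ht hu
  simpa using h

lemma abs_poissonWeight_taylor_le {t p : ℝ} (ht : 0 ≤ t) (hp : 0 ≤ p) (i s : ℕ) :
    |poissonWeight (t + p) i s - poissonWeight t i s -
      p * (poissonWeight t i (s + 1) - poissonWeight t i s)| ≤ 2 * p ^ 2 := by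
  set d := poissonWeight t i (s + 1) - poissonWeight t i s with hd
  have h := (convex_Icc t (t + p)).norm_image_sub_le_of_norm_hasDerivWithin_le (C := 2 * p)
    (f := fun u => poissonWeight u i s - u * d) (x := t) (y := t + p)
    (fun v _ => ((hasDerivAt_poissonWeight v i s).sub
      ((hasDerivAt_id v).mul_const d)).hasDerivWithinAt)
    (fun v hv => by
      have hv0 : 0 ≤ v := ht.trans hv.1
      have h1 := abs_poissonWeight_sub_le ht hv0 i (s + 1)
      have h2 := abs_poissonWeight_sub_le ht hv0 i s
      have h3 : |v - t| ≤ p := by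
        rw [abs_of_nonneg (by linarith [hv.1])]
        linarith [hv.2]
      rw [Real.norm_eq_abs, abs_le]
      rw [abs_le] at h1 h2
      constructor <;> linarith)
    ⟨le_rfl, by linarith⟩ ⟨by linarith, le_rfl⟩
  simp only [Real.norm_eq_abs, add_sub_cancel_left, abs_of_nonneg hp] at h
  calc _ = |poissonWeight (t + p) i s - (t + p) * d - (poissonWeight t i s - t * d)| := by
        congr 1
        ring
    _ ≤ 2 * p * p := h
    _ = _ := by ring

/-! ### Occurrences of a random word in a random sequence -/

section Occurrences

variable {b k N : ℕ} [NeZero b]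

/-- A finite sequence, continued by zeros. -/
def extendWord (x : Fin N → Fin b) : ℕ → Fin b :=
  fun i => if h : i < N then x ⟨i, h⟩ else 0

/-- The word `v` placed at the coordinates `J, …, J + k - 1`, zero elsewhere. -/
def placeWord (N J : ℕ) (v : Fin k → Fin b) : Fin N → Fin b :=
  fun i => if h : J ≤ (i : ℕ) ∧ (i : ℕ) < J + k then v ⟨i - J, by omega⟩ else 0

/-- The indicator that `w` occurs in `x` at the coordinates `l, …, l + k - 1`. -/
def occInd {b k : ℕ} (x : ℕ → Fin b) (l : ℕ) (w : Fin k → Fin b) : ℝ :=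
  if OccursAt x (l + 1) w then 1 else 0

/-- The number of occurrences of `w` in `x` that start at one of the first `n` coordinates. -/
def occCount {b k : ℕ} (n : ℕ) (x : ℕ → Fin b) (w : Fin k → Fin b) : ℕ :=
  ((Finset.range n).filter fun l => OccursAt x (l + 1) w).card

lemma occursAt_succ_iff {b k : ℕ} {x : ℕ → Fin b} {l : ℕ} {w : Fin k → Fin b} :
    OccursAt x (l + 1) w ↔ ∀ t : Fin k, x (l + t) = w t := by
  simp [OccursAt]

lemma occInd_nonneg {b k : ℕ} (x : ℕ → Fin b) (l : ℕ) (w : Fin k → Fin b) :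
    0 ≤ occInd x l w := by
  unfold occInd
  split_ifs <;> norm_num

lemma cast_occCount {b k : ℕ} (n : ℕ) (x : ℕ → Fin b) (w : Fin k → Fin b) :
    (occCount n x w : ℝ) = ∑ l ∈ Finset.range n, occInd x l w := by
  simp [occCount, occInd, Finset.sum_boole]

lemma occCount_congr {b k : ℕ} {n m : ℕ} {x y : ℕ → Fin b} (hnm : n + k ≤ m + 1)
    (h : ∀ i < m, x i = y i) (w : Fin k → Fin b) : occCount n x w = occCount n y w := by
  unfold occCount
  congr 1
  refine Finset.filter_congr fun l hl => ?_
  rw [occursAt_succ_iff, occursAt_succ_iff]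
  refine forall_congr' fun t => ?_
  have := Finset.mem_range.1 hl
  rw [h (l + t) (by omega)]

lemma extendWord_add_placeWord {J : ℕ} (hJ : J + k ≤ N) (x : Fin N → Fin b)
    (v : Fin k → Fin b) (t : Fin k) :
    extendWord (x + placeWord N J v) (J + t) = extendWord x (J + t) + v t := by
  have h1 : J + (t : ℕ) < N := by omega
  simp [extendWord, placeWord, h1]

lemma extendWord_add_placeWord_of_lt {J i : ℕ} (hi : i < J) (x : Fin N → Fin b)
    (v : Fin k → Fin b) :
    extendWord (x + placeWord N J v) i = extendWord x i := by
  have h1 : ¬ (J ≤ i ∧ i < J + k) := by omega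
  simp [extendWord, placeWord, h1]

lemma expect_resample (J : ℕ) (F : (Fin N → Fin b) → ℝ) :
    𝔼 x, F x = 𝔼 x, 𝔼 v : Fin k → Fin b, F (x + placeWord N J v) := by
  rw [Finset.expect_comm]
  have h : ∀ v : Fin k → Fin b, 𝔼 x, F (x + placeWord N J v) = 𝔼 x, F x := fun v =>
    Fintype.expect_equiv (Equiv.addRight (placeWord N J v)) _ _ fun _ => rfl
  simp only [h, Fintype.expect_const]

lemma expect_indicator_le_of_subsingleton {b k : ℕ} {P : (Fin k → Fin b) → Prop} [DecidablePred P]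
    (hP : ∀ v v', P v → P v' → v = v') :
    𝔼 v, (if P v then (1 : ℝ) else 0) ≤ ((b : ℝ) ^ k)⁻¹ := by
  rw [Fintype.expect_eq_sum_div_card, Finset.sum_boole, div_eq_mul_inv]
  have h : (Finset.univ.filter P).card ≤ 1 := Finset.card_le_one.2 fun v hv v' hv' =>
    hP v v' (Finset.mem_filter.1 hv).2 (Finset.mem_filter.1 hv').2
  have h' : ((Finset.univ.filter P).card : ℝ) ≤ 1 := by exact_mod_cast h
  simpa using mul_le_mul_of_nonneg_right h' (by positivity : (0 : ℝ) ≤ ((b : ℝ) ^ k)⁻¹)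

/-- Occurrence of a fixed word is independent of the earlier coordinates. -/
lemma expect_occInd_mul {J : ℕ} (hJ : J + k ≤ N) (w : Fin k → Fin b) (G : (ℕ → Fin b) → ℝ)
    (hG : ∀ y y', (∀ i < J, y i = y' i) → G y = G y') :
    𝔼 x : Fin N → Fin b, occInd (extendWord x) J w * G (extendWord x) =
      ((b : ℝ) ^ k)⁻¹ * 𝔼 x : Fin N → Fin b, G (extendWord x) := by
  rw [expect_resample (k := k) J, Finset.mul_expect]
  refine Finset.expect_congr rfl fun x _ => ?_
  have h : ∀ v : Fin k → Fin b,
      occInd (extendWord (x + placeWord N J v)) J w * G (extendWord (x + placeWord N J v)) =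
      (if v = fun t => w t - extendWord x (J + t) then 1 else 0) * G (extendWord x) := fun v => by
    rw [hG _ (extendWord x) fun i hi => extendWord_add_placeWord_of_lt hi x v]
    congr 1
    unfold occInd
    refine if_congr ?_ rfl rfl
    rw [occursAt_succ_iff, funext_iff]
    refine forall_congr' fun t => ?_
    rw [extendWord_add_placeWord hJ, eq_sub_iff_add_eq, add_comm]
  simp only [h]
  rw [← Finset.expect_mul, Fintype.expect_eq_sum_div_card]
  simp

lemma expect_occInd {J : ℕ} (hJ : J + k ≤ N) (w : Fin k → Fin b) :
    𝔼 x : Fin N → Fin b, occInd (extendWord x) J w = ((b : ℝ) ^ k)⁻¹ := by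
  simpa using expect_occInd_mul hJ w (fun _ => 1) fun _ _ _ => rfl

/-- Occurrences of a uniformly random word at two different places are uncorrelated. -/
lemma expect_occInd_mul_occInd_le {l J : ℕ} (hl : l < J) (hJ : J + k ≤ N) :
    𝔼 w : Fin k → Fin b, 𝔼 x : Fin N → Fin b,
      occInd (extendWord x) J w * occInd (extendWord x) l w ≤ ((b : ℝ) ^ k)⁻¹ ^ 2 := by
  have hp : (0 : ℝ) ≤ ((b : ℝ) ^ k)⁻¹ := by positivity
  have hinner : ∀ y : ℕ → Fin b, 𝔼 w : Fin k → Fin b, occInd y J w * occInd y l w ≤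
      (if ∀ t : Fin k, y (J + t) = y (l + t) then 1 else 0) * ((b : ℝ) ^ k)⁻¹ := fun y => by
    split_ifs with h
    · rw [one_mul]
      refine le_trans (Finset.expect_le_expect fun w _ => ?_)
        (expect_indicator_le_of_subsingleton (P := fun w : Fin k → Fin b =>
          w = fun t : Fin k => y (J + t)) fun v v' hv hv' => hv.trans hv'.symm)
      unfold occInd
      simp only [occursAt_succ_iff]
      by_cases hw : ∀ t : Fin k, y (J + t) = w t
      · have : w = fun t : Fin k => y (J + t) := funext fun t => (hw t).symm
        rw [if_pos hw, if_pos this]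
        split_ifs <;> norm_num
      · rw [if_neg hw, zero_mul]
        split_ifs <;> norm_num
    · rw [zero_mul]
      refine (Finset.expect_eq_zero fun w _ => ?_).le
      unfold occInd
      simp only [occursAt_succ_iff]
      by_contra hne
      refine h fun t => ?_
      have h1 : ∀ t : Fin k, y (J + t) = w t := by
        by_contra h1
        simp [h1] at hne
      have h2 : ∀ t : Fin k, y (l + t) = w t := by
        by_contra h2
        simp [h2] at hne
      rw [h1, h2]
  rw [Finset.expect_comm]
  refine (Finset.expect_le_expect fun x _ => hinner (extendWord x)).trans ?_
  rw [← Finset.expect_mul, sq]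
  refine mul_le_mul_of_nonneg_right ?_ hp
  rw [expect_resample (k := k) J]
  refine (Finset.expect_le_expect (g := fun _ => ((b : ℝ) ^ k)⁻¹) fun x _ => ?_).trans_eq
    (Fintype.expect_const _)
  refine expect_indicator_le_of_subsingleton fun v v' hv hv' => funext fun t => ?_
  obtain ⟨t, ht⟩ := t
  induction t using Nat.strong_induction_on with
  | _ t ih =>
    have e := hv ⟨t, ht⟩
    have e' := hv' ⟨t, ht⟩
    rw [extendWord_add_placeWord hJ] at e e'
    have hsame : extendWord (x + placeWord N J v) (l + t) =
        extendWord (x + placeWord N J v') (l + t) := by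
      rcases lt_or_ge (l + t) J with h | h
      · rw [extendWord_add_placeWord_of_lt h, extendWord_add_placeWord_of_lt h]
      · obtain ⟨r, hr⟩ := Nat.exists_eq_add_of_le h
        have hrt : r < t := by omega
        have h1 := extendWord_add_placeWord hJ x v ⟨r, by omega⟩
        have h2 := extendWord_add_placeWord hJ x v' ⟨r, by omega⟩
        simp only at h1 h2
        rw [hr, h1, h2, ih r hrt (by omega)]
    exact add_left_cancel (e.trans (hsame.trans e'.symm))

end Occurrences

/-! ### Poisson approximation for the averaged occurrence count -/

lemma expect_prod_eq {α β : Type*} [Fintype α] [Fintype β] (f : α → β → ℝ) :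
    𝔼 z : α × β, f z.1 z.2 = 𝔼 a, 𝔼 c, f a c := by
  rw [← Finset.univ_product_univ, Finset.expect_product' (f := f)]

/-- One step of the replacement of the occurrence indicators by Poisson variables. -/
lemma abs_expect_poissonWeight_occCount_step_le {b k N J : ℕ} [NeZero b] (hk : 1 ≤ k)
    (hJ : J + k ≤ N) {t p : ℝ} (ht : 0 ≤ t) (hp : p = ((b : ℝ) ^ k)⁻¹) (i : ℕ) :
    |𝔼 z : (Fin k → Fin b) × (Fin N → Fin b),
      (poissonWeight t i (occCount (J + 1) (extendWord z.2) z.1) -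
        poissonWeight (t + p) i (occCount J (extendWord z.2) z.1))| ≤ (4 * k - 2) * p ^ 2 := by
  have hp0 : 0 ≤ p := by
    rw [hp]
    positivity
  set I : ℕ → (Fin k → Fin b) × (Fin N → Fin b) → ℝ :=
    fun l z => occInd (extendWord z.2) l z.1 with hI
  set S : ℕ → (Fin k → Fin b) × (Fin N → Fin b) → ℕ :=
    fun l z => occCount l (extendWord z.2) z.1 with hS
  set D : ℕ → ℝ := fun s => poissonWeight t i (s + 1) - poissonWeight t i s with hD
  have hI0 : ∀ l z, 0 ≤ I l z := fun l z => occInd_nonneg _ _ _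
  have hImean : ∀ l, l + k ≤ N → 𝔼 z, I l z = p := fun l hl => by
    rw [hI, expect_prod_eq fun w x => occInd (extendWord x) l w]
    simp only [expect_occInd hl, hp, Fintype.expect_const]
  have hIpair : ∀ l < J, 𝔼 z, I J z * I l z ≤ p ^ 2 := fun l hl => by
    rw [hI, expect_prod_eq fun w x => occInd (extendWord x) J w * occInd (extendWord x) l w, hp]
    exact expect_occInd_mul_occInd_le hl hJ
  have hcenter : 𝔼 z, (I J z - p) * D (S (J + 1 - k) z) = 0 := by
    have h : 𝔼 z, I J z * D (S (J + 1 - k) z) = p * 𝔼 z, D (S (J + 1 - k) z) := by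
      rw [hI, hS, expect_prod_eq fun w x => occInd (extendWord x) J w *
        D (occCount (J + 1 - k) (extendWord x) w),
        expect_prod_eq fun w x => D (occCount (J + 1 - k) (extendWord x) w), Finset.mul_expect]
      refine Finset.expect_congr rfl fun w _ => ?_
      rw [hp]
      rcases Nat.lt_or_ge (J + 1) k with hkJ | hkJ
      · have h0 : J + 1 - k = 0 := by omega
        exact expect_occInd_mul hJ w (fun y => D (occCount (J + 1 - k) y w)) fun y y' _ => by
          simp [h0, occCount]
      · exact expect_occInd_mul hJ w (fun y => D (occCount (J + 1 - k) y w)) fun y y' hy => by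
          rw [occCount_congr (m := J) (by omega) hy]
    simp only [sub_mul]
    rw [Finset.expect_sub_distrib, h, ← Finset.mul_expect, sub_self]
  have hdecomp : ∀ z, (S J z : ℝ) = S (J + 1 - k) z + ∑ l ∈ Finset.Ico (J + 1 - k) J, I l z :=
    fun z => by
      rw [hS, hI]
      simp only [cast_occCount]
      rw [Finset.sum_range_add_sum_Ico _ (by omega)]
  have hDdiff : ∀ z, |D (S J z) - D (S (J + 1 - k) z)| ≤
      2 * ∑ l ∈ Finset.Ico (J + 1 - k) J, I l z := fun z => by
    have hsum := Finset.sum_nonneg fun l (_ : l ∈ Finset.Ico (J + 1 - k) J) => hI0 l z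
    have hz := hdecomp z
    rcases eq_or_ne (S J z) (S (J + 1 - k) z) with h | h
    · rw [h, sub_self, abs_zero]
      positivity
    · have hlt : S (J + 1 - k) z < S J z := by
        refine lt_of_le_of_ne ?_ h.symm
        have : (S (J + 1 - k) z : ℝ) ≤ S J z := by linarith
        exact_mod_cast this
      have hlt' : (S (J + 1 - k) z : ℝ) + 1 ≤ S J z := by exact_mod_cast hlt
      have h1 := abs_poissonWeight_sub_le_one ht ht i (S J z + 1) i (S J z)
      have h2 := abs_poissonWeight_sub_le_one ht ht i (S (J + 1 - k) z + 1) i (S (J + 1 - k) z)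
      have h3 := abs_sub (D (S J z)) (D (S (J + 1 - k) z))
      simp only [hD] at h3 ⊢
      linarith
  have hpoint : ∀ z, |poissonWeight t i (S (J + 1) z) - poissonWeight (t + p) i (S J z) -
      (I J z - p) * D (S (J + 1 - k) z)| ≤
      ∑ l ∈ Finset.Ico (J + 1 - k) J, 2 * (I J z * I l z + p * I l z) + 2 * p ^ 2 := fun z => by
    have htaylor := abs_poissonWeight_taylor_le ht hp0 i (S J z)
    have hsucc : poissonWeight t i (S (J + 1) z) =
        poissonWeight t i (S J z) + I J z * D (S J z) := by
      simp only [hS, hI, hD, occCount, occInd, Finset.range_add_one, Finset.filter_insert]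
      split_ifs
      · rw [Finset.card_insert_of_notMem (by simp)]
        ring
      · ring
    have hcoef : |I J z - p| ≤ I J z + p := by
      have := hI0 J z
      rw [abs_le]
      constructor <;> linarith
    have hprod : |(I J z - p) * (D (S J z) - D (S (J + 1 - k) z))| ≤
        (I J z + p) * (2 * ∑ l ∈ Finset.Ico (J + 1 - k) J, I l z) := by
      rw [abs_mul]
      exact mul_le_mul hcoef (hDdiff z) (abs_nonneg _) (by linarith [hI0 J z])
    have hsum : ∑ l ∈ Finset.Ico (J + 1 - k) J, 2 * (I J z * I l z + p * I l z) =
        (I J z + p) * (2 * ∑ l ∈ Finset.Ico (J + 1 - k) J, I l z) := by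
      rw [← mul_assoc, Finset.mul_sum]
      exact Finset.sum_congr rfl fun l _ => by ring
    rw [hsum, hsucc]
    calc _ = |(I J z - p) * (D (S J z) - D (S (J + 1 - k) z)) -
          (poissonWeight (t + p) i (S J z) - poissonWeight t i (S J z) - p * D (S J z))| := by
          congr 1
          ring
      _ ≤ _ := (abs_sub _ _).trans (add_le_add hprod htaylor)
  calc _ = |𝔼 z, (poissonWeight t i (S (J + 1) z) - poissonWeight (t + p) i (S J z) -
        (I J z - p) * D (S (J + 1 - k) z))| := by
        rw [Finset.expect_sub_distrib _ _ fun z => (I J z - p) * D (S (J + 1 - k) z), hcenter,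
          sub_zero]
    _ ≤ 𝔼 z, (∑ l ∈ Finset.Ico (J + 1 - k) J, 2 * (I J z * I l z + p * I l z) + 2 * p ^ 2) :=
        (Finset.abs_expect_le _ _).trans (Finset.expect_le_expect fun z _ => hpoint z)
    _ = ∑ l ∈ Finset.Ico (J + 1 - k) J, 2 * (𝔼 z, I J z * I l z + p * 𝔼 z, I l z) +
          2 * p ^ 2 := by
        rw [Finset.expect_add_distrib, Fintype.expect_const, Finset.expect_sum_comm]
        congr 1
        refine Finset.sum_congr rfl fun l _ => ?_
        rw [← Finset.mul_expect, Finset.expect_add_distrib, ← Finset.mul_expect]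
    _ ≤ ∑ _l ∈ Finset.Ico (J + 1 - k) J, 4 * p ^ 2 + 2 * p ^ 2 := by
        refine add_le_add (Finset.sum_le_sum fun l hl => ?_) le_rfl
        have hl' := Finset.mem_Ico.1 hl
        rw [hImean l (by omega)]
        linarith [hIpair l hl'.2]
    _ ≤ (k - 1) * (4 * p ^ 2) + 2 * p ^ 2 := by
        rw [Finset.sum_const, Nat.card_Ico, nsmul_eq_mul]
        have hcard : J - (J + 1 - k) + 1 ≤ k := by omega
        have hcard' : ((J - (J + 1 - k) : ℕ) : ℝ) + 1 ≤ k := by exact_mod_cast hcard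
        gcongr
        linarith
    _ = _ := by ring

/-- The number of occurrences of a random word in a random sequence is nearly Poisson. -/
lemma abs_expect_occCount_sub_poisson_le {b k n : ℕ} [NeZero b] (hk : 1 ≤ k) {lam p : ℝ}
    (hp : p = ((b : ℝ) ^ k)⁻¹) (hn : n * p ≤ lam) (hn' : lam ≤ n * p + p) (hlam : lam ≤ k)
    (i : ℕ) :
    |𝔼 z : (Fin k → Fin b) × (Fin (n + k) → Fin b),
      (if occCount n (extendWord z.2) z.1 = i then (1 : ℝ) else 0) - poissonWeight lam i 0| ≤
      4 * k ^ 2 * p := by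
  have hp0 : 0 ≤ p := by
    rw [hp]
    positivity
  have hk' : (1 : ℝ) ≤ k := by exact_mod_cast hk
  set Φ : ℕ → ℝ := fun J => 𝔼 z : (Fin k → Fin b) × (Fin (n + k) → Fin b),
    poissonWeight (lam - J * p) i (occCount J (extendWord z.2) z.1) with hΦ
  have hstep : ∀ J < n, |Φ (J + 1) - Φ J| ≤ (4 * k - 2) * p ^ 2 := fun J hJ => by
    have hJn : ((J + 1 : ℕ) : ℝ) * p ≤ n * p := by
      gcongr
      exact hJ
    have h := abs_expect_poissonWeight_occCount_step_le (N := n + k) (J := J) hk (by omega)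
      (t := lam - (J + 1 : ℕ) * p) (by linarith) hp i
    have ht : lam - ((J + 1 : ℕ) : ℝ) * p + p = lam - J * p := by
      push_cast
      ring
    rw [ht, Finset.expect_sub_distrib] at h
    exact h
  have htel : ∀ m ≤ n, |Φ m - Φ 0| ≤ m * ((4 * k - 2) * p ^ 2) := fun m => by
    induction m with
    | zero => simp
    | succ m ih =>
      intro hm
      have h1 := hstep m hm
      have h2 := ih (by omega)
      have h3 := abs_sub_le (Φ (m + 1)) (Φ m) (Φ 0)
      push_cast
      linarith
  have hzero : Φ 0 = poissonWeight lam i 0 := by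
    simp [hΦ, occCount]
  have hend : |𝔼 z : (Fin k → Fin b) × (Fin (n + k) → Fin b),
      (if occCount n (extendWord z.2) z.1 = i then (1 : ℝ) else 0) - Φ n| ≤ p := by
    rw [hΦ, ← Finset.expect_sub_distrib]
    refine (Finset.abs_expect_le _ _).trans ?_
    refine (Finset.expect_le_expect (g := fun _ => p) fun z _ => ?_).trans_eq
      (Fintype.expect_const p)
    rw [← poissonWeight_zero]
    refine (abs_poissonWeight_sub_le (sub_nonneg.2 hn) le_rfl i _).trans ?_
    rw [abs_le]
    constructor <;> linarith
  have h1 := htel n le_rfl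
  rw [hzero] at h1
  have h2 := abs_sub_le (𝔼 z : (Fin k → Fin b) × (Fin (n + k) → Fin b),
      (if occCount n (extendWord z.2) z.1 = i then (1 : ℝ) else 0)) (Φ n) (poissonWeight lam i 0)
  have h3 : n * ((4 * k - 2) * p ^ 2) ≤ k * ((4 * k - 2) * p) := by
    calc _ = (n * p) * ((4 * k - 2) * p) := by ring
      _ ≤ _ := by
        have : (0 : ℝ) ≤ (4 * k - 2) * p := mul_nonneg (by linarith) hp0
        gcongr
        linarith
  nlinarith

/-! ### The proportion of words with a given number of occurrences -/

/-- The words of length `k` that occur exactly `i` times among the first `n`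
positions of `x`. -/
def wordsWithCount (b k n i : ℕ) (x : ℕ → Fin b) : Finset (Fin k → Fin b) :=
  Finset.univ.filter fun w => occCount n x w = i

lemma wordsWithCount_subset_union {b k n i m : ℕ} {x y : ℕ → Fin b}
    (hxy : ∀ j, j ≠ m → x j = y j) :
    wordsWithCount b k n i x ⊆ wordsWithCount b k n i y ∪
      ((Finset.Ico (m + 1 - k) (m + 1)).image (fun l => fun t : Fin k => x (l + t)) ∪
        (Finset.Ico (m + 1 - k) (m + 1)).image fun l => fun t : Fin k => y (l + t)) := by
  intro w hw
  by_contra hcon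
  simp only [Finset.mem_union, Finset.mem_image, not_or, not_exists, not_and,
    wordsWithCount, Finset.mem_filter, Finset.mem_univ, true_and] at hcon hw
  obtain ⟨h1, h2, h3⟩ := hcon
  refine h1 (Eq.trans ?_ hw)
  unfold occCount
  congr 1
  refine Finset.filter_congr fun l _ => ?_
  rw [occursAt_succ_iff, occursAt_succ_iff]
  by_cases hl : l ∈ Finset.Ico (m + 1 - k) (m + 1)
  · exact iff_of_false (fun h => h3 l hl (funext h)) fun h => h2 l hl (funext h)
  · rw [Finset.mem_Ico] at hl
    refine forall_congr' fun t => ?_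
    rw [hxy (l + t) (by omega)]

lemma abs_card_wordsWithCount_sub_le {b k n i m : ℕ} {x y : ℕ → Fin b}
    (hxy : ∀ j, j ≠ m → x j = y j) :
    |((wordsWithCount b k n i x).card : ℝ) - (wordsWithCount b k n i y).card| ≤ 2 * k := by
  have key : ∀ x y : ℕ → Fin b, (∀ j, j ≠ m → x j = y j) →
      ((wordsWithCount b k n i x).card : ℝ) ≤ (wordsWithCount b k n i y).card + 2 * k :=
    fun x y hxy => by
      have hcard : (Finset.Ico (m + 1 - k) (m + 1)).card ≤ k := by
        rw [Nat.card_Ico]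
        omega
      have h := (Finset.card_le_card (wordsWithCount_subset_union (k := k) (n := n) (i := i)
        hxy)).trans (Finset.card_union_le _ _)
      have h2 := Finset.card_union_le
        ((Finset.Ico (m + 1 - k) (m + 1)).image (fun l => fun t : Fin k => x (l + t)))
        ((Finset.Ico (m + 1 - k) (m + 1)).image fun l => fun t : Fin k => y (l + t))
      have h3 : (wordsWithCount b k n i x).card ≤ (wordsWithCount b k n i y).card + 2 * k := by
        have := Finset.card_image_le (s := Finset.Ico (m + 1 - k) (m + 1))
          (f := fun l => fun t : Fin k => x (l + t))
        have := Finset.card_image_le (s := Finset.Ico (m + 1 - k) (m + 1))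
          (f := fun l => fun t : Fin k => y (l + t))
        omega
      exact_mod_cast h3
  rw [abs_le]
  constructor
  · linarith [key y x fun j hj => (hxy j hj).symm]
  · linarith [key x y hxy]

lemma Mx_Ioc_eq_occCount {b k : ℕ} (hb : 0 < b) {lam : ℝ} (hlam : 0 ≤ lam) (x : ℕ → Fin b)
    (w : Fin k → Fin b) :
    Mx b k (Set.Ioc 0 lam) x w = occCount ⌊lam * (b : ℝ) ^ k⌋₊ x w := by
  have hB : (0 : ℝ) < (b : ℝ) ^ k := by positivity
  have hset : {j : ℕ | 1 ≤ j ∧ ((j : ℝ) / (b : ℝ) ^ k) ∈ Set.Ioc 0 lam ∧ OccursAt x j w} =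
      (((Finset.range ⌊lam * (b : ℝ) ^ k⌋₊).filter fun l => OccursAt x (l + 1) w).image
        (· + 1) : Finset ℕ) := by
    ext j
    simp only [Set.mem_ofPred_eq, Set.mem_Ioc, Finset.coe_image, Finset.coe_filter,
      Finset.mem_range, Set.mem_image]
    constructor
    · rintro ⟨h1, ⟨_, h2⟩, h3⟩
      obtain ⟨l, rfl⟩ := Nat.exists_eq_add_of_le' h1
      refine ⟨l, ⟨?_, h3⟩, rfl⟩
      rw [← Nat.succ_le_iff, Nat.le_floor_iff (by positivity)]
      exact (div_le_iff₀ hB).1 h2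
    · rintro ⟨l, ⟨h1, h2⟩, rfl⟩
      refine ⟨by omega, ⟨by positivity, ?_⟩, h2⟩
      rw [div_le_iff₀ hB]
      exact (Nat.le_floor_iff (by positivity)).1 h1
  rw [Mx, hset, Set.ncard_coe_finset, Finset.card_image_of_injective _ (add_left_injective 1),
    occCount]

lemma muK_apply_toReal {b k : ℕ} (A : Finset (Fin k → Fin b)) :
    (muK b k (A : Set (Fin k → Fin b))).toReal = A.card / (b : ℝ) ^ k := by
  rw [muK, Measure.smul_apply, Measure.count_apply_finset, smul_eq_mul, ENNReal.toReal_mul]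
  simp [div_eq_inv_mul]

lemma measure_prefix_le {b : ℕ} {ν : Measure (ℕ → Fin b)} (hν : IsUnifProductMeasure b ν) {N : ℕ}
    (A : Finset (Fin N → Fin b)) :
    ν {x | (fun t : Fin N => x t) ∈ A} ≤ A.card * ((b : ENNReal)⁻¹) ^ N := by
  have h : {x : ℕ → Fin b | (fun t : Fin N => x t) ∈ A} ⊆
      ⋃ w ∈ A, {x | ∀ t : Fin N, x (t : ℕ) = w t} := fun x hx =>
    Set.mem_biUnion (x := fun t : Fin N => x t) hx fun _ => rfl
  calc _ ≤ _ := measure_mono h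
    _ ≤ ∑ w ∈ A, ν {x | ∀ t : Fin N, x (t : ℕ) = w t} := measure_biUnion_finset_le _ _
    _ = _ := by simp [hν N]

lemma measure_BadSet_le {b k i : ℕ} (hb : 0 < b) (hk : 1 ≤ k) (hkb : 6 * k ^ 5 ≤ b ^ k)
    {ν : Measure (ℕ → Fin b)} (hν : IsUnifProductMeasure b ν) {lam : ℝ} (hlam : lam ∈ Lset k) :
    ν (BadSet b k i lam) ≤
      ENNReal.ofReal (2 * Real.exp (-2 * (b : ℝ) ^ k / (k : ℝ) ^ 5)) := by
  have : NeZero b := ⟨hb.ne'⟩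
  have hk' : (1 : ℝ) ≤ k := by exact_mod_cast hk
  have hk0 : (0 : ℝ) < k := by linarith
  obtain ⟨p', q', hp', hq', hqk, rfl, hlt⟩ := hlam
  set lam : ℝ := (p' : ℝ) / q' with hlamdef
  have hq0 : (0 : ℝ) < q' := by exact_mod_cast hq'
  have hlam0 : 0 ≤ lam := by positivity
  have hlamk : lam ≤ k - 1 / k := by
    have h1 : p' + 1 ≤ k * q' := by
      rw [hlamdef, div_lt_iff₀ hq0] at hlt
      exact_mod_cast hlt
    have h2 : (p' : ℝ) + 1 ≤ k * q' := by exact_mod_cast h1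
    have h3 : (1 : ℝ) / k ≤ 1 / q' := one_div_le_one_div_of_le hq0 (by exact_mod_cast hqk)
    have h4 : lam + 1 / q' ≤ k := by
      rw [hlamdef, ← add_div, div_le_iff₀ hq0]
      exact h2
    linarith
  set B : ℝ := (b : ℝ) ^ k with hB
  have hB0 : 0 < B := by positivity
  have hkB : 6 * (k : ℝ) ^ 5 ≤ B := by
    rw [hB]
    exact_mod_cast hkb
  set n := ⌊lam * B⌋₊ with hn
  have hn1 : (n : ℝ) ≤ lam * B := Nat.floor_le (by positivity)
  have hn2 : lam * B ≤ n + 1 := (Nat.lt_floor_add_one _).le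
  set f : (Fin (n + k) → Fin b) → ℝ :=
    fun x => (wordsWithCount b k n i (extendWord x)).card / B with hf
  have hfdiff : ∀ x m a, |f (Function.update x m a) - f x| ≤ 2 * k / B := fun x m a => by
    rw [hf]
    simp only
    rw [← sub_div, abs_div, abs_of_pos hB0]
    gcongr
    refine abs_card_wordsWithCount_sub_le (m := m) fun j hj => ?_
    unfold extendWord
    split_ifs with h
    · exact Function.update_of_ne (fun h' => hj (by rw [← h'])) _ _
    · rfl
  have hmean : |𝔼 x, f x - poissonWeight lam i 0| ≤ 4 * k ^ 2 * B⁻¹ := by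
    have h := abs_expect_occCount_sub_poisson_le (b := b) (k := k) (n := n) hk
      (p := B⁻¹) (lam := lam) (by rw [hB])
      (by rw [← div_eq_mul_inv, div_le_iff₀ hB0]; exact hn1)
      (by rw [← add_one_mul, ← div_eq_mul_inv, le_div_iff₀ hB0]; exact hn2) hlt.le i
    rw [expect_prod_eq fun w x =>
      if occCount n (extendWord x) w = i then (1 : ℝ) else 0, Finset.expect_comm] at h
    convert h using 4 with x
    rw [hf, Fintype.expect_eq_sum_div_card, Finset.sum_boole]
    simp [hB, wordsWithCount]
  have hN0 : 0 < n + k := by omega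
  have ht : 0 ≤ 2 / (k : ℝ) - 4 * k ^ 2 * B⁻¹ := by
    rw [sub_nonneg, ← div_eq_mul_inv, div_le_div_iff₀ hB0 hk0]
    have : (k : ℝ) ^ 3 ≤ k ^ 5 := pow_le_pow_right₀ hk' (by norm_num)
    nlinarith
  have hconc := card_abs_tail_le_of_bounded_differences (c := 2 * k / B) (by positivity) ht hN0 f
    hfdiff
  have hexp : Real.exp (-2 * (2 / (k : ℝ) - 4 * k ^ 2 * B⁻¹) ^ 2 /
      ((n + k : ℕ) * (2 * k / B) ^ 2)) ≤ Real.exp (-2 * B / (k : ℝ) ^ 5) := by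
    refine Real.exp_le_exp.2 ?_
    have hNle : ((n + k : ℕ) : ℝ) ≤ (k - 1 / k) * B + k := by
      push_cast
      nlinarith
    have hNpos : (0 : ℝ) < ((n + k : ℕ) : ℝ) := by exact_mod_cast hN0
    have hmain : B * (((n + k : ℕ) : ℝ) * (2 * k / B) ^ 2) ≤
        (2 / (k : ℝ) - 4 * k ^ 2 * B⁻¹) ^ 2 * k ^ 5 := by
      calc _ ≤ B * (((k - 1 / k) * B + k) * (2 * k / B) ^ 2) := by gcongr
        _ = (4 * k ^ 3 - 4 * k + 4 * k ^ 3 / B) := by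
          field_simp
          ring
        _ ≤ 4 * k ^ 3 - 16 * k ^ 6 / B := by
          rw [← sub_nonneg]
          have : 4 * (k : ℝ) ^ 3 - 16 * k ^ 6 / B - (4 * k ^ 3 - 4 * k + 4 * k ^ 3 / B) =
              4 * k * (B - 4 * k ^ 5 - k ^ 2) / B := by
            field_simp
            ring
          rw [this]
          have h2 : (k : ℝ) ^ 2 ≤ k ^ 5 := pow_le_pow_right₀ hk' (by norm_num)
          have : 0 ≤ B - 4 * k ^ 5 - (k : ℝ) ^ 2 := by nlinarith
          positivity
        _ ≤ 4 * k ^ 3 - 16 * k ^ 6 / B + (4 * k ^ 2 * B⁻¹) ^ 2 * k ^ 5 := by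
          have : 0 ≤ (4 * (k : ℝ) ^ 2 * B⁻¹) ^ 2 * k ^ 5 := by positivity
          linarith
        _ = _ := by
          field_simp
          ring
    rw [div_le_div_iff₀ (by positivity) (by positivity)]
    linarith
  have hsub : BadSet b k i lam ⊆ {x | (fun t : Fin (n + k) => x t) ∈
      Finset.univ.filter fun x => 2 / (k : ℝ) - 4 * k ^ 2 * B⁻¹ ≤ |f x - 𝔼 y, f y|} := by
    intro x hx
    simp only [BadSet, Set.mem_ofPred_eq] at hx
    simp only [Finset.mem_filter, Finset.mem_univ, true_and, Set.mem_ofPred_eq]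
    have hfx : ((muK b k) {w : Fin k → Fin b | Mx b k (Set.Ioc 0 lam) x w = i}).toReal =
        f (fun t : Fin (n + k) => x t) := by
      have hset : {w : Fin k → Fin b | Mx b k (Set.Ioc 0 lam) x w = i} =
          (wordsWithCount b k n i (extendWord fun t : Fin (n + k) => x t) :
            Set (Fin k → Fin b)) := by
        ext w
        simp only [Set.mem_ofPred_eq, wordsWithCount, Finset.coe_filter, Finset.mem_univ, true_and]
        rw [Mx_Ioc_eq_occCount hb hlam0, ← hB, ← hn,
          occCount_congr (m := n + k) (by omega) (y := extendWord fun t : Fin (n + k) => x t)]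
        intro j hj
        simp [extendWord, hj]
      rw [hset, muK_apply_toReal]
    have hpois : Real.exp (-lam) * lam ^ i / (Nat.factorial i : ℝ) = poissonWeight lam i 0 := by
      simp [poissonWeight]
    rw [hfx, hpois] at hx
    have h := abs_sub_le (f fun t : Fin (n + k) => x t) (𝔼 y, f y) (poissonWeight lam i 0)
    linarith
  refine (measure_mono hsub).trans ((measure_prefix_le hν _).trans ?_)
  have hcardreal : (Fintype.card (Fin (n + k) → Fin b) : ℝ) = (b : ℝ) ^ (n + k) := by simp
  rw [hcardreal] at hconc
  have hbN : (0 : ℝ) < (b : ℝ) ^ (n + k) := by positivity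
  have hb' : (0 : ℝ) < b := by exact_mod_cast hb
  have hinv : ((b : ENNReal)⁻¹) ^ (n + k) = ENNReal.ofReal (((b : ℝ) ^ (n + k))⁻¹) := by
    rw [ENNReal.ofReal_inv_of_pos hbN, ENNReal.ofReal_pow hb'.le, ENNReal.ofReal_natCast,
      ENNReal.inv_pow]
  rw [hinv, ← ENNReal.ofReal_natCast, ← ENNReal.ofReal_mul (by positivity)]
  refine ENNReal.ofReal_le_ofReal ?_
  rw [← div_eq_mul_inv, div_le_iff₀ hbN]
  refine hconc.trans ?_
  calc _ ≤ 2 * (b : ℝ) ^ (n + k) * Real.exp (-2 * B / (k : ℝ) ^ 5) := by gcongr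
    _ = _ := by ring

/-! ### The union of the bad sets -/

/-- A finite set of reals that contains `Lset k`. -/
noncomputable def LsetCover (k : ℕ) : Finset ℝ :=
  (Finset.Icc 1 k ×ˢ Finset.range (k ^ 2)).image fun z => (z.2 : ℝ) / (z.1 : ℝ)

lemma Lset_subset_cover (k : ℕ) : Lset k ⊆ LsetCover k := by
  rintro r ⟨p, q, _, hq, hqk, rfl, hlt⟩
  rw [LsetCover, Finset.mem_coe, Finset.mem_image]
  refine ⟨(q, p), Finset.mem_product.2 ⟨Finset.mem_Icc.2 ⟨hq, hqk⟩, Finset.mem_range.2 ?_⟩, rfl⟩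
  rw [div_lt_iff₀ (by exact_mod_cast hq)] at hlt
  have h : p < k * q := by exact_mod_cast hlt
  calc p < k * q := h
    _ ≤ k * k := Nat.mul_le_mul_left k hqk
    _ = k ^ 2 := (sq k).symm

lemma card_LsetCover_le (k : ℕ) : (LsetCover k).card ≤ k ^ 3 := by
  refine Finset.card_image_le.trans_eq ?_
  rw [Finset.card_product, Nat.card_Icc, Finset.card_range, Nat.add_sub_cancel]
  ring

lemma measure_Oset_le_of_le {b k : ℕ} (hb : 0 < b) (hk : 1 ≤ k) (hkb : 6 * k ^ 5 ≤ b ^ k)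
    {ν : Measure (ℕ → Fin b)} (hν : IsUnifProductMeasure b ν) :
    ν (Oset b k) ≤ ENNReal.ofReal
      (2 * (b : ℝ) ^ k * (k : ℝ) ^ 3 * Real.exp (-2 * (b : ℝ) ^ k / (k : ℝ) ^ 5)) := by
  classical
  set ε : ℝ := 2 * Real.exp (-2 * (b : ℝ) ^ k / (k : ℝ) ^ 5) with hε
  have hε0 : 0 ≤ ε := by positivity
  set T := (LsetCover k).filter (· ∈ Lset k) with hT
  have hTcard : T.card ≤ k ^ 3 := (Finset.card_filter_le _ _).trans (card_LsetCover_le k)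
  have hsub : Oset b k ⊆ ⋃ lam ∈ T, ⋃ i ∈ Finset.range (b ^ k), BadSet b k i lam :=
    Set.iUnion₂_subset fun lam hlam => Set.subset_biUnion_of_mem
      (u := fun lam => ⋃ i ∈ Finset.range (b ^ k), BadSet b k i lam)
      (Finset.mem_filter.2 ⟨Lset_subset_cover k hlam, hlam⟩)
  calc ν (Oset b k) ≤ ∑ lam ∈ T, ∑ i ∈ Finset.range (b ^ k), ν (BadSet b k i lam) :=
        (measure_mono hsub).trans ((measure_biUnion_finset_le _ _).trans
          (Finset.sum_le_sum fun lam _ => measure_biUnion_finset_le _ _))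
    _ ≤ ∑ _lam ∈ T, ∑ _i ∈ Finset.range (b ^ k), ENNReal.ofReal ε :=
        Finset.sum_le_sum fun lam hlam => Finset.sum_le_sum fun i _ =>
          measure_BadSet_le hb hk hkb hν (Finset.mem_filter.1 hlam).2
    _ = ENNReal.ofReal (T.card * ((b : ℝ) ^ k * ε)) := by
        rw [ENNReal.ofReal_mul (p := (T.card : ℝ)) (by positivity),
          ENNReal.ofReal_mul (p := (b : ℝ) ^ k) (by positivity),
          ENNReal.ofReal_pow (by positivity)]
        simp
    _ ≤ _ := by
        refine ENNReal.ofReal_le_ofReal ?_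
        have h : (T.card : ℝ) ≤ (k : ℝ) ^ 3 := by exact_mod_cast hTcard
        calc _ ≤ (k : ℝ) ^ 3 * ((b : ℝ) ^ k * ε) := by gcongr
          _ = _ := by
            rw [hε]
            ring

lemma IsUnifProductMeasure.measure_le_one {b : ℕ} {ν : Measure (ℕ → Fin b)}
    (hν : IsUnifProductMeasure b ν) (s : Set (ℕ → Fin b)) : ν s ≤ 1 := by
  have h := hν 0 Fin.elim0
  simp only [pow_zero] at h
  exact (measure_mono fun x _ => by simp).trans_eq h

lemma measure_Oset_le {b k : ℕ} (hb : 2 ≤ b) (hk : 24 ≤ k)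
    {ν : Measure (ℕ → Fin b)} (hν : IsUnifProductMeasure b ν) :
    ν (Oset b k) ≤ ENNReal.ofReal
      (2 * (b : ℝ) ^ k * (k : ℝ) ^ 3 * Real.exp (-2 * (b : ℝ) ^ k / (k : ℝ) ^ 5)) := by
  rcases le_or_gt (6 * k ^ 5) (b ^ k) with h | h
  · exact measure_Oset_le_of_le (by omega) (by omega) h hν
  · refine (hν.measure_le_one _).trans (ENNReal.one_le_ofReal.2 ?_)
    have hk0 : (0 : ℝ) < k := by
      have : 0 < k := by omega
      exact_mod_cast this
    have h' : (b : ℝ) ^ k ≤ 6 * (k : ℝ) ^ 5 := by exact_mod_cast h.le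
    have hexp : (3 : ℝ)⁻¹ ^ 12 ≤ Real.exp (-2 * (b : ℝ) ^ k / (k : ℝ) ^ 5) := by
      have h1 : (3 : ℝ)⁻¹ ≤ Real.exp (-1) := by
        rw [Real.exp_neg]
        exact inv_anti₀ (Real.exp_pos 1) (by linarith [Real.exp_one_lt_d9])
      calc (3 : ℝ)⁻¹ ^ 12 ≤ Real.exp (-1) ^ 12 := by gcongr
        _ = Real.exp (-12) := by
          rw [← Real.exp_nat_mul]
          norm_num
        _ ≤ _ := by
          refine Real.exp_le_exp.2 ?_
          rw [le_div_iff₀ (by positivity)]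
          linarith
    have hpow : (2 : ℝ) ^ 24 ≤ (b : ℝ) ^ k := by
      have h1 : 2 ^ 24 ≤ b ^ k :=
        (Nat.pow_le_pow_right (by norm_num) hk).trans (Nat.pow_le_pow_left hb k)
      exact_mod_cast h1
    have hk3 : (1 : ℝ) ≤ (k : ℝ) ^ 3 := one_le_pow₀ (by exact_mod_cast (by omega : 1 ≤ k))
    calc (1 : ℝ) ≤ 2 * 2 ^ 24 * 1 * 3⁻¹ ^ 12 := by norm_num
      _ ≤ _ := by gcongr

lemma measure_Oset_le_poly_mul_geometric {b k : ℕ} (hb : 2 ≤ b) (hk : 1 ≤ k)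
    {ν : Measure (ℕ → Fin b)} (hν : IsUnifProductMeasure b ν) :
    ν (Oset b k) ≤ ENNReal.ofReal ((b : ℝ) ^ 24 * ((k : ℝ) ^ 13 * ((b : ℝ)⁻¹) ^ k)) := by
  have hb1 : (1 : ℝ) ≤ b := by exact_mod_cast (by omega : 1 ≤ b)
  have hk1 : (1 : ℝ) ≤ k := by exact_mod_cast hk
  have hB0 : (0 : ℝ) < (b : ℝ) ^ k := by positivity
  rcases le_or_gt 24 k with h | h
  · refine (measure_Oset_le hb h hν).trans (ENNReal.ofReal_le_ofReal ?_)
    set y : ℝ := 2 * (b : ℝ) ^ k / (k : ℝ) ^ 5 with hy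
    have hy0 : 0 < y := by positivity
    have hexp : Real.exp (-2 * (b : ℝ) ^ k / (k : ℝ) ^ 5) ≤ 2 / y ^ 2 := by
      have h1 := Real.pow_div_factorial_le_exp y hy0.le 2
      have h2 : -2 * (b : ℝ) ^ k / (k : ℝ) ^ 5 = -y := by
        rw [hy]
        ring
      rw [h2, Real.exp_neg, ← inv_div]
      exact inv_anti₀ (by positivity) (by simpa using h1)
    calc _ ≤ 2 * (b : ℝ) ^ k * (k : ℝ) ^ 3 * (2 / y ^ 2) := by gcongr
      _ = 1 * ((k : ℝ) ^ 13 * ((b : ℝ)⁻¹) ^ k) := by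
        rw [hy, inv_pow]
        field_simp
      _ ≤ _ := by
        gcongr
        exact one_le_pow₀ hb1
  · refine (hν.measure_le_one _).trans (ENNReal.one_le_ofReal.2 ?_)
    have h1 : (1 : ℝ) ≤ (k : ℝ) ^ 13 := one_le_pow₀ hk1
    have h2 : (b : ℝ) ^ k ≤ (b : ℝ) ^ 24 := pow_le_pow_right₀ hb1 h.le
    calc (1 : ℝ) = (b : ℝ) ^ k * (1 * ((b : ℝ)⁻¹) ^ k) := by
          rw [inv_pow]
          field_simp
      _ ≤ _ := by gcongr

lemma tsum_measure_Oset_lt_top {b : ℕ} (hb : 2 ≤ b)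
    {ν : Measure (ℕ → Fin b)} (hν : IsUnifProductMeasure b ν) :
    ∑' k : ℕ, ν (Oset b (k + 1)) < ⊤ := by
  have hsum : Summable fun k : ℕ =>
      (b : ℝ) ^ 24 * (((k + 1 : ℕ) : ℝ) ^ 13 * ((b : ℝ)⁻¹) ^ (k + 1)) := by
    have hb1 : (1 : ℝ) < b := by exact_mod_cast (by omega : 1 < b)
    have h : Summable fun k : ℕ => (k : ℝ) ^ 13 * ((b : ℝ)⁻¹) ^ k :=
      summable_pow_mul_geometric_of_norm_lt_one 13 (by
        rw [norm_inv, Real.norm_of_nonneg (by positivity)]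
        exact inv_lt_one_of_one_lt₀ hb1)
    exact ((summable_nat_add_iff 1).2 h).mul_left _
  refine (ENNReal.tsum_le_tsum fun k =>
    measure_Oset_le_poly_mul_geometric hb (Nat.le_add_left 1 k) hν).trans_lt ?_
  exact hsum.tsum_ofReal_lt_top

theorem stmt12 (b : ℕ) (hb : 2 ≤ b) (ν : Measure (ℕ → Fin b))
    (hν : IsUnifProductMeasure b ν) :
    (∀ k : ℕ, 24 ≤ k →
      ν (Oset b k) ≤ ENNReal.ofReal
        (2 * (b : ℝ) ^ k * (k : ℝ) ^ 3 * Real.exp (-2 * (b : ℝ) ^ k / (k : ℝ) ^ 5))) ∧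
    (∑' k : ℕ, ν (Oset b (k + 1))) < ⊤ := by
  exact ⟨fun k hk => measure_Oset_le hb hk hν, tsum_measure_Oset_lt_top hb hν⟩
end

section
/- Define Bad(λ,k,i), L_k, J_k and O_k as follows: Bad(λ,k,i) = {x ∈ Ω^ℕ : |μ^k({ω : M_k^x((0,λ])(ω) = i}) − e^{−λ}λ^i/i!| > 2/k}, L_k = {p/q : p,q positive integers, q ≤ k, p/q < k}, J_k = {0,…,b^k−1}, O_k = ∪_{λ∈L_k} ∪_{i∈J_k} Bad(λ,k,i). If x ∈ Ω^ℕ belongs to only finitely many of the sets O_k (i.e., there is m₀ such that x ∉ O_k for all k ≥ m₀), then x is Poisson generic. -/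
open MeasureTheory Filter

/-- If antitone-in-the-parameter functions converge at all positive rationals to a function which
is continuous on the reals, then they converge at all positive reals. -/
theorem tendsto_of_antitone_of_tendsto_rat {g : ℕ → ℝ → ℝ} {G : ℝ → ℝ}
    (hg : ∀ k, Antitone (g k)) (hG : Continuous G)
    (hrat : ∀ r : ℚ, 0 < r → Tendsto (fun k => g k r) atTop (nhds (G r)))
    {lam : ℝ} (hlam : 0 < lam) : Tendsto (fun k => g k lam) atTop (nhds (G lam)) := by
  rw [tendsto_order]
  constructor
  · intro a ha
    have hev : ∀ᶠ y in nhdsWithin lam (Set.Ioi lam), a < G y :=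
      (hG.tendsto lam).mono_left nhdsWithin_le_nhds (lt_mem_nhds ha)
    obtain ⟨u, hu, hsub⟩ := mem_nhdsGT_iff_exists_Ioo_subset.1 hev
    obtain ⟨r, hlr, hru⟩ := exists_rat_btwn (Set.mem_Ioi.1 hu)
    have hr : 0 < r := by exact_mod_cast hlam.trans hlr
    filter_upwards [(hrat r hr).eventually (lt_mem_nhds (hsub ⟨hlr, hru⟩))] with k hk
    exact hk.trans_le (hg k hlr.le)
  · intro a ha
    have hev : ∀ᶠ y in nhdsWithin lam (Set.Iio lam), G y < a :=
      (hG.tendsto lam).mono_left nhdsWithin_le_nhds (gt_mem_nhds ha)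
    obtain ⟨u, hu, hsub⟩ := mem_nhdsLT_iff_exists_Ioo_subset.1 hev
    obtain ⟨r, hlr, hru⟩ := exists_rat_btwn (max_lt (Set.mem_Iio.1 hu) hlam)
    have hr : 0 < r := by exact_mod_cast (le_max_right _ _).trans_lt hlr
    filter_upwards [(hrat r hr).eventually
      (gt_mem_nhds (hsub ⟨(le_max_left _ _).trans_lt hlr, hru⟩))] with k hk
    exact (hg k hru.le).trans_lt hk

theorem isFiniteMeasure_muK {b : ℕ} (hb : 0 < b) (k : ℕ) : IsFiniteMeasure (muK b k) := by
  refine ⟨?_⟩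
  rw [muK, Measure.smul_apply, smul_eq_mul]
  refine ENNReal.mul_lt_top ?_ (measure_lt_top _ _)
  exact ENNReal.inv_lt_top.2 (ENNReal.pow_pos (by exact_mod_cast hb) k)

theorem Mx_Ioc_mono {b : ℕ} (hb : 0 < b) (k : ℕ) (x : ℕ → Fin b) (w : Fin k → Fin b) :
    Monotone fun lam : ℝ => Mx b k (Set.Ioc 0 lam) x w := by
  intro lam lam' hle
  have hpos : (0 : ℝ) < (b : ℝ) ^ k := by positivity
  refine Set.ncard_le_ncard ?_ ?_
  · rintro j ⟨hj, hmem, hocc⟩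
    exact ⟨hj, ⟨hmem.1, hmem.2.trans hle⟩, hocc⟩
  · refine (Set.finite_Iic ⌊lam' * (b : ℝ) ^ k⌋₊).subset ?_
    rintro j ⟨-, hmem, -⟩
    exact Nat.le_floor ((div_le_iff₀ hpos).1 hmem.2)

theorem muK_Mx_lt_succ {b : ℕ} (hb : 0 < b) (k n : ℕ) (S : Set ℝ) (x : ℕ → Fin b) :
    (muK b k).real {w | Mx b k S x w < n + 1} =
      (muK b k).real {w | Mx b k S x w < n} + (muK b k).real {w | Mx b k S x w = n} := by
  have := isFiniteMeasure_muK hb k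
  rw [← measureReal_union _ (Set.toFinite _).measurableSet]
  · congr 1
    ext w
    exact Nat.lt_succ_iff_lt_or_eq
  · rw [Set.disjoint_left]
    intro w h₁ h₂
    exact h₁.ne h₂

theorem muK_Mx_lt_eq_sum {b : ℕ} (hb : 0 < b) (k n : ℕ) (S : Set ℝ) (x : ℕ → Fin b) :
    (muK b k).real {w | Mx b k S x w < n} =
      ∑ i ∈ Finset.range n, (muK b k).real {w | Mx b k S x w = i} := by
  induction n with
  | zero => simp
  | succ n ih => rw [muK_Mx_lt_succ hb, ih, Finset.sum_range_succ]

theorem antitone_muK_Mx_lt {b : ℕ} (hb : 0 < b) (k n : ℕ) (x : ℕ → Fin b) :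
    Antitone fun lam : ℝ => (muK b k).real {w | Mx b k (Set.Ioc 0 lam) x w < n} := by
  have := isFiniteMeasure_muK hb k
  intro lam lam' hle
  refine measureReal_mono fun w hw => ?_
  exact (Mx_Ioc_mono hb k x w hle).trans_lt hw

theorem tendsto_muK_Mx_eq_rat {b : ℕ} (hb : 2 ≤ b) {x : ℕ → Fin b} {m0 : ℕ}
    (h : ∀ k : ℕ, m0 ≤ k → x ∉ Oset b k) (i : ℕ) {r : ℚ} (hr : 0 < r) :
    Tendsto (fun k : ℕ => (muK b k).real {w | Mx b k (Set.Ioc 0 (r : ℝ)) x w = i}) atTop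
      (nhds (Real.exp (-r) * (r : ℝ) ^ i / (Nat.factorial i : ℝ))) := by
  rw [tendsto_iff_dist_tendsto_zero]
  refine squeeze_zero' (Eventually.of_forall fun _ => dist_nonneg) ?_
    (tendsto_const_div_atTop_nhds_zero_nat 2)
  obtain ⟨N, hN⟩ := exists_nat_gt (r : ℝ)
  filter_upwards [eventually_ge_atTop m0, eventually_ge_atTop N, eventually_ge_atTop r.den,
    eventually_ge_atTop i] with k hkm hkN hkd hki
  by_contra hlt
  refine h k hkm ?_
  simp only [Oset, Set.mem_iUnion]
  refine ⟨r, ⟨r.num.toNat, r.den, ?_, r.den_pos, hkd, ?_, ?_⟩, i, ?_, ?_⟩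
  · have := Rat.num_pos.2 hr
    omega
  · have hnum : ((r.num.toNat : ℤ) : ℝ) = r.num := by
      rw [Int.toNat_of_nonneg (Rat.num_pos.2 hr).le]
    rw [← Int.cast_natCast r.num.toNat, hnum]
    exact Rat.cast_def r
  · exact hN.trans_le (by exact_mod_cast hkN)
  · exact Finset.mem_range.2 (hki.trans_lt (Nat.lt_pow_self (by omega)))
  · exact not_le.1 hlt

theorem stmt13 (b : ℕ) (hb : 2 ≤ b) (x : ℕ → Fin b) (m0 : ℕ)
    (h : ∀ k : ℕ, m0 ≤ k → x ∉ Oset b k) :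
    PoissonGenericM b x := by
  have hb0 : 0 < b := by omega
  have hlt : ∀ n : ℕ, ∀ lam : ℝ, 0 < lam →
      Tendsto (fun k => (muK b k).real {w | Mx b k (Set.Ioc 0 lam) x w < n}) atTop
        (nhds (∑ i ∈ Finset.range n, Real.exp (-lam) * lam ^ i / (Nat.factorial i : ℝ))) := by
    intro n lam hlam
    refine tendsto_of_antitone_of_tendsto_rat
      (G := fun y => ∑ i ∈ Finset.range n, Real.exp (-y) * y ^ i / (Nat.factorial i : ℝ))
      (fun k => antitone_muK_Mx_lt hb0 k n x) (by fun_prop) (fun r hr => ?_) hlam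
    simp only [muK_Mx_lt_eq_sum hb0]
    exact tendsto_finsetSum _ fun i _ => tendsto_muK_Mx_eq_rat hb h i hr
  intro lam hlam i
  have hsub := (hlt (i + 1) lam hlam).sub (hlt i lam hlam)
  rw [Finset.sum_range_succ, add_sub_cancel_left] at hsub
  refine hsub.congr fun k => ?_
  rw [muK_Mx_lt_succ hb0, add_sub_cancel_left]
  rfl
end

section
/- If x ∈ Ω^ℕ is λ-Poisson generic for every positive rational λ, then x is λ-Poisson generic for every positive real λ, i.e., x is Poisson generic. -/
open MeasureTheory Filter

/-- The number of words that occur exactly `i` times among the first `N` positions changes by at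
most `M - N` when the window grows to the first `M` positions. -/
lemma abs_card_occurrences_sub_le {b : ℕ} (x : ℕ → Fin b) (k i : ℕ) {N M : ℕ} (hNM : N ≤ M) :
    |((Finset.univ.filter (fun w : Fin k → Fin b =>
        ((Finset.Icc 1 N).filter (fun j => OccursAt x j w)).card = i)).card : ℝ)
      - ((Finset.univ.filter (fun w : Fin k → Fin b =>
        ((Finset.Icc 1 M).filter (fun j => OccursAt x j w)).card = i)).card : ℝ)|
      ≤ (M : ℝ) - N := by
  classical
  set D : Finset (Fin k → Fin b) :=
    (Finset.Ioc N M).image (fun j => fun t : Fin k => x (j - 1 + (t : ℕ))) with hD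
  have hDcard : D.card ≤ M - N := Finset.card_image_le.trans (by simp)
  have agree : ∀ w : Fin k → Fin b, w ∉ D →
      (Finset.Icc 1 N).filter (fun j => OccursAt x j w)
        = (Finset.Icc 1 M).filter (fun j => OccursAt x j w) := by
    intro w hw
    ext j
    simp only [Finset.mem_filter, Finset.mem_Icc]
    refine ⟨fun ⟨⟨h₁, h₂⟩, h₃⟩ => ⟨⟨h₁, h₂.trans hNM⟩, h₃⟩, fun ⟨⟨h₁, h₂⟩, h₃⟩ => ⟨⟨h₁, ?_⟩, h₃⟩⟩
    by_contra hj
    exact hw (Finset.mem_image.2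
      ⟨j, Finset.mem_Ioc.2 ⟨not_le.1 hj, h₂⟩, funext fun t => h₃ t⟩)
  set A := Finset.univ.filter (fun w : Fin k → Fin b =>
    ((Finset.Icc 1 N).filter (fun j => OccursAt x j w)).card = i) with hA
  set B := Finset.univ.filter (fun w : Fin k → Fin b =>
    ((Finset.Icc 1 M).filter (fun j => OccursAt x j w)).card = i) with hB
  have hAB : A ⊆ B ∪ D := by
    intro w hw
    by_cases hwD : w ∈ D
    · exact Finset.mem_union_right _ hwD
    · refine Finset.mem_union_left _ ?_
      simp only [hA, hB, Finset.mem_filter, Finset.mem_univ, true_and] at hw ⊢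
      rwa [← agree w hwD]
  have hBA : B ⊆ A ∪ D := by
    intro w hw
    by_cases hwD : w ∈ D
    · exact Finset.mem_union_right _ hwD
    · refine Finset.mem_union_left _ ?_
      simp only [hA, hB, Finset.mem_filter, Finset.mem_univ, true_and] at hw ⊢
      rwa [agree w hwD]
  have h₁ : A.card + N ≤ B.card + M := by
    have := (Finset.card_le_card hAB).trans (Finset.card_union_le _ _)
    omega
  have h₂ : B.card + N ≤ A.card + M := by
    have := (Finset.card_le_card hBA).trans (Finset.card_union_le _ _)
    omega
  have h₁' : (A.card : ℝ) + N ≤ B.card + M := by exact_mod_cast h₁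
  have h₂' : (B.card : ℝ) + N ≤ A.card + M := by exact_mod_cast h₂
  rw [abs_le]
  constructor <;> linarith

lemma abs_Z_sub_Z_le {b : ℕ} (hb : 0 < b) (x : ℕ → Fin b) (k i : ℕ) {lam q : ℝ}
    (hlam : 0 ≤ lam) (hlq : lam ≤ q) :
    |Z b k i lam x - Z b k i q x| ≤ q - lam + ((b : ℝ)⁻¹) ^ k := by
  have hpos : (0 : ℝ) < (b : ℝ) ^ k := by positivity
  have hfloor : ⌊lam * (b : ℝ) ^ k⌋₊ ≤ ⌊q * (b : ℝ) ^ k⌋₊ := Nat.floor_le_floor (by gcongr)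
  have hupper := Nat.floor_le (mul_nonneg (hlam.trans hlq) hpos.le)
  have hlower := Nat.lt_floor_add_one (lam * (b : ℝ) ^ k)
  unfold Z
  rw [← sub_div, abs_div, abs_of_pos hpos, div_le_iff₀ hpos]
  refine (abs_card_occurrences_sub_le x k i hfloor).trans ?_
  have : (q - lam + ((b : ℝ)⁻¹) ^ k) * (b : ℝ) ^ k = q * (b : ℝ) ^ k - lam * (b : ℝ) ^ k + 1 := by
    rw [inv_pow]
    field_simp
  rw [this]
  linarith

theorem stmt14 (b : ℕ) (hb : 2 ≤ b) (x : ℕ → Fin b)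
    (h : ∀ lam : ℚ, 0 < lam → LamPoissonGeneric b (lam : ℝ) x) :
    PoissonGeneric b x := by
  intro lam hlam i
  have hcont : Continuous fun l : ℝ => Real.exp (-l) * l ^ i / (Nat.factorial i : ℝ) := by
    fun_prop
  rw [Metric.tendsto_nhds]
  intro ε hε
  obtain ⟨δ, hδ, hclose⟩ := Metric.continuousAt_iff.1 (hcont.continuousAt (x := lam)) (ε / 4)
    (by positivity)
  obtain ⟨q, hq, hq'⟩ := exists_rat_btwn (lt_add_of_pos_right lam (lt_min hδ (by positivity :
    0 < ε / 4)))
  have hqδ : (q : ℝ) - lam < δ := by linarith [min_le_left δ (ε / 4)]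
  have hqε : (q : ℝ) - lam < ε / 4 := by linarith [min_le_right δ (ε / 4)]
  have hlimit := hclose (x := (q : ℝ)) (by rwa [Real.dist_eq, abs_of_pos (by linarith)])
  have hb' : (1 : ℝ) < b := by exact_mod_cast hb
  have hinv : Tendsto (fun k : ℕ => ((b : ℝ)⁻¹) ^ k) atTop (nhds 0) :=
    tendsto_pow_atTop_nhds_zero_of_lt_one (by positivity) (inv_lt_one_of_one_lt₀ hb')
  have hq0 : 0 < q := by exact_mod_cast hlam.trans hq
  filter_upwards [hinv.eventually_lt_const (by positivity : 0 < ε / 4),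
    Metric.tendsto_nhds.1 (h q hq0 i) (ε / 4) (by positivity)] with k hk hZ
  have hdiff := abs_Z_sub_Z_le (by omega) x k i hlam.le hq.le
  rw [← Real.dist_eq] at hdiff
  have htri := dist_triangle4 (Z b k i lam x) (Z b k i q x)
    (Real.exp (-(q : ℝ)) * (q : ℝ) ^ i / (Nat.factorial i : ℝ))
    (Real.exp (-lam) * lam ^ i / (Nat.factorial i : ℝ))
  linarith
end

section
/- There exists a computable sequence x : ℕ → Ω (computable in the sense of computability theory) that is Poisson generic. Moreover, for every finite word w over Ω there exists a computable Poisson generic sequence having w as a prefix; hence the computable Poisson generic elements of Ω^ℕ form a countably infinite dense subset of Ω^ℕ. -/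
open MeasureTheory Filter

namespace PoissonGenericity

variable {b : ℕ}

/-- The block of length `k` of `y` at the position `j`, positions being numbered from `0`. -/
def block (k : ℕ) (y : ℕ → Fin b) (j : ℕ) : Fin k → Fin b := fun i => y (j + i)

/-- The number of occurrences of `ω` in `y` at positions below `t`. -/
def occ (k : ℕ) (y : ℕ → Fin b) (t : ℕ) (ω : Fin k → Fin b) : ℕ :=
  ((Finset.range t).filter fun j => block k y j = ω).card

/-- The probability generating function, at `s`, of the number of occurrences at positions
below `t` of a uniformly random word of length `k`. -/
noncomputable def pgf (k : ℕ) (s : ℝ) (y : ℕ → Fin b) (t : ℕ) : ℝ :=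
  (∑ ω : Fin k → Fin b, s ^ occ k y t ω) / (b : ℝ) ^ k

/-- The deviation of `pgf` from the generating function of a binomial law. -/
noncomputable def dev (k : ℕ) (s : ℝ) (y : ℕ → Fin b) (t : ℕ) : ℝ :=
  pgf k s y t - (1 - (1 - s) / (b : ℝ) ^ k) ^ t

/-- The sequence `y` with the word `u` written over it from position `T` on. -/
def overwrite (y : ℕ → Fin b) (T : ℕ) {L : ℕ} (u : Fin L → Fin b) : ℕ → Fin b :=
  fun n => if h : T ≤ n ∧ n < T + L then u ⟨n - T, by omega⟩ else y n

theorem occ_succ (k : ℕ) (y : ℕ → Fin b) (t : ℕ) (ω : Fin k → Fin b) :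
    occ k y (t + 1) ω = occ k y t ω + if block k y t = ω then 1 else 0 := by
  unfold occ
  rw [Finset.range_add_one, Finset.filter_insert]
  split_ifs with h
  · rw [Finset.card_insert_of_notMem (by simp)]
  · simp

theorem occ_add (k : ℕ) (y : ℕ → Fin b) (t n : ℕ) (ω : Fin k → Fin b) :
    occ k y (t + n) ω =
      occ k y t ω + ∑ j ∈ Finset.range n, if block k y (t + j) = ω then 1 else 0 := by
  induction n with
  | zero => simp
  | succ n ih => rw [← add_assoc, occ_succ, ih, Finset.sum_range_succ, add_assoc]

theorem occ_congr {k t : ℕ} {y z : ℕ → Fin b} (h : ∀ n, n + 1 < t + k → y n = z n) :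
    occ k y t = occ k z t := by
  funext ω
  unfold occ
  congr 1
  refine Finset.filter_congr fun j hj => ?_
  have : block k y j = block k z j := by
    funext i
    refine h _ ?_
    have := i.2
    have := Finset.mem_range.1 hj
    omega
  rw [this]

theorem pgf_congr {k t : ℕ} {s : ℝ} {y z : ℕ → Fin b} (h : ∀ n, n + 1 < t + k → y n = z n) :
    pgf k s y t = pgf k s z t := by
  unfold pgf
  rw [occ_congr h]

theorem dev_congr {k t : ℕ} {s : ℝ} {y z : ℕ → Fin b} (h : ∀ n, n + 1 < t + k → y n = z n) :
    dev k s y t = dev k s z t := by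
  unfold dev
  rw [pgf_congr h]

theorem overwrite_of_lt (y : ℕ → Fin b) {T L n : ℕ} (u : Fin L → Fin b) (h : n < T) :
    overwrite y T u n = y n := by
  unfold overwrite
  rw [dif_neg (by omega)]

theorem overwrite_add (y : ℕ → Fin b) (T : ℕ) {L : ℕ} (u : Fin L → Fin b) (i : Fin L) :
    overwrite y T u (T + i) = u i := by
  unfold overwrite
  rw [dif_pos (by omega)]
  congr 1
  ext
  simp

theorem block_overwrite (k : ℕ) (y : ℕ → Fin b) (t : ℕ) (v : Fin k → Fin b) :
    block k (overwrite y t v) t = v := by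
  funext i
  exact overwrite_add y t v i

theorem pgf_zero [NeZero b] (k : ℕ) (s : ℝ) (y : ℕ → Fin b) : pgf k s y 0 = 1 := by
  have : (b : ℝ) ≠ 0 := by exact_mod_cast NeZero.ne b
  simp [pgf, occ, this]

theorem dev_zero [NeZero b] (k : ℕ) (s : ℝ) (y : ℕ → Fin b) : dev k s y 0 = 0 := by
  simp [dev, pgf_zero]

theorem pgf_succ (k : ℕ) (s : ℝ) (y : ℕ → Fin b) (t : ℕ) :
    pgf k s y (t + 1) =
      pgf k s y t + (s - 1) / (b : ℝ) ^ k * s ^ occ k y t (block k y t) := by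
  have key : ∀ ω : Fin k → Fin b, s ^ occ k y (t + 1) ω =
      s ^ occ k y t ω + if block k y t = ω then (s - 1) * s ^ occ k y t ω else 0 := by
    intro ω
    rw [occ_succ]
    split_ifs
    · ring
    · simp
  unfold pgf
  simp_rw [key]
  rw [Finset.sum_add_distrib, Finset.sum_ite_eq]
  simp only [Finset.mem_univ, if_true]
  ring

theorem pgf_nonneg (k : ℕ) {s : ℝ} (hs : 0 ≤ s) (y : ℕ → Fin b) (t : ℕ) : 0 ≤ pgf k s y t := by
  unfold pgf
  positivity

theorem pgf_le_one [NeZero b] (k : ℕ) {s : ℝ} (hs : 0 ≤ s) (hs1 : s ≤ 1) (y : ℕ → Fin b)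
    (t : ℕ) : pgf k s y t ≤ 1 := by
  have hb : (0 : ℝ) < b := by exact_mod_cast NeZero.pos b
  unfold pgf
  rw [div_le_one (by positivity)]
  calc ∑ ω : Fin k → Fin b, s ^ occ k y t ω ≤ ∑ ω : Fin k → Fin b, (1 : ℝ) :=
        Finset.sum_le_sum fun ω _ => pow_le_one₀ hs hs1
    _ = (b : ℝ) ^ k := by simp

theorem one_le_card_pow [NeZero b] (k : ℕ) : (1 : ℝ) ≤ (b : ℝ) ^ k := by
  exact_mod_cast Nat.one_le_pow _ _ (NeZero.pos b)

theorem inv_pow_le_one [NeZero b] (k : ℕ) : ((b : ℝ) ^ k)⁻¹ ≤ 1 :=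
  inv_le_one_of_one_le₀ (one_le_card_pow k)

theorem inv_pow_pos [NeZero b] (k : ℕ) : 0 < ((b : ℝ) ^ k)⁻¹ :=
  inv_pos.2 (by linarith [one_le_card_pow (b := b) k])

theorem ratio_mem [NeZero b] (k : ℕ) {s : ℝ} (hs : 0 ≤ s) (hs1 : s ≤ 1)
    : 0 ≤ 1 - (1 - s) / (b : ℝ) ^ k ∧ 1 - (1 - s) / (b : ℝ) ^ k ≤ 1 := by
  have h1 := inv_pow_le_one (b := b) k
  have h2 := inv_pow_pos (b := b) k
  rw [div_eq_mul_inv]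
  constructor <;> nlinarith

theorem abs_dev_le_one [NeZero b] (k : ℕ) {s : ℝ} (hs : 0 ≤ s) (hs1 : s ≤ 1)
    (y : ℕ → Fin b) (t : ℕ) : |dev k s y t| ≤ 1 := by
  obtain ⟨h1, h2⟩ := ratio_mem (b := b) k hs hs1
  have h3 := pow_le_one₀ h1 h2 (n := t)
  have h4 := pow_nonneg h1 t
  have h5 := pgf_nonneg k hs y t
  have h6 := pgf_le_one k hs hs1 y t
  unfold dev
  rw [abs_le]
  constructor <;> linarith

theorem abs_pgf_succ_sub_le [NeZero b] (k : ℕ) {s : ℝ} (hs : 0 ≤ s) (hs1 : s ≤ 1)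
    (y : ℕ → Fin b) (t : ℕ) :
    |pgf k s y (t + 1) - pgf k s y t| ≤ ((b : ℝ) ^ k)⁻¹ := by
  have h2 := inv_pow_pos (b := b) k
  have h3 := pow_le_one₀ hs hs1 (n := occ k y t (block k y t))
  have h4 := pow_nonneg hs (occ k y t (block k y t))
  rw [pgf_succ, add_sub_cancel_left, abs_mul, div_eq_mul_inv, abs_mul, abs_of_nonneg h4,
    abs_of_pos h2, abs_of_nonpos (by linarith : s - 1 ≤ 0)]
  have : -(s - 1) * s ^ occ k y t (block k y t) ≤ 1 * 1 :=
    mul_le_mul (by linarith) h3 h4 (by norm_num)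
  nlinarith

theorem abs_dev_succ_sub_le [NeZero b] (k : ℕ) {s : ℝ} (hs : 0 ≤ s) (hs1 : s ≤ 1)
    (y : ℕ → Fin b) (t : ℕ) :
    |dev k s y (t + 1) - dev k s y t| ≤ ((b : ℝ) ^ k)⁻¹ := by
  obtain ⟨h1, h2⟩ := ratio_mem (b := b) k hs hs1
  have hq := inv_pow_pos (b := b) k
  have h3 := pow_le_one₀ h1 h2 (n := t)
  have h4 := pow_nonneg h1 t
  have h5 := pow_le_one₀ hs hs1 (n := occ k y t (block k y t))
  have h6 := pow_nonneg hs (occ k y t (block k y t))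
  have key : dev k s y (t + 1) - dev k s y t = ((b : ℝ) ^ k)⁻¹ * ((1 - s) *
      ((1 - (1 - s) / (b : ℝ) ^ k) ^ t - s ^ occ k y t (block k y t))) := by
    unfold dev
    rw [pgf_succ]
    ring
  rw [key, abs_mul, abs_of_pos hq]
  refine mul_le_of_le_one_right hq.le ?_
  rw [abs_mul, abs_of_nonneg (by linarith : 0 ≤ 1 - s)]
  refine mul_le_one₀ (by linarith) (abs_nonneg _) ?_
  rw [abs_le]
  constructor <;> linarith

theorem abs_pgf_add_sub_le [NeZero b] (k : ℕ) {s : ℝ} (hs : 0 ≤ s) (hs1 : s ≤ 1)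
    (y : ℕ → Fin b) (t n : ℕ) :
    |pgf k s y (t + n) - pgf k s y t| ≤ n * ((b : ℝ) ^ k)⁻¹ := by
  induction n with
  | zero => simp
  | succ n ih =>
    have := abs_pgf_succ_sub_le k hs hs1 y (t + n)
    have h3 := abs_sub_le (pgf k s y (t + (n + 1))) (pgf k s y (t + n)) (pgf k s y t)
    rw [← add_assoc] at *
    push_cast
    linarith

theorem abs_dev_add_sub_le [NeZero b] (k : ℕ) {s : ℝ} (hs : 0 ≤ s) (hs1 : s ≤ 1)
    (y : ℕ → Fin b) (t n : ℕ) :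
    |dev k s y (t + n) - dev k s y t| ≤ n * ((b : ℝ) ^ k)⁻¹ := by
  induction n with
  | zero => simp
  | succ n ih =>
    have := abs_dev_succ_sub_le k hs hs1 y (t + n)
    have h3 := abs_sub_le (dev k s y (t + (n + 1))) (dev k s y (t + n)) (dev k s y t)
    rw [← add_assoc] at *
    push_cast
    linarith

theorem sq_dev_add_le [NeZero b] (k : ℕ) {s : ℝ} (hs : 0 ≤ s) (hs1 : s ≤ 1)
    (y : ℕ → Fin b) (t n : ℕ) :
    dev k s y (t + n) ^ 2 ≤ dev k s y t ^ 2 + 2 * n * ((b : ℝ) ^ k)⁻¹ := by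
  have h1 := abs_le.1 (abs_dev_le_one k hs hs1 y t)
  have h2 := abs_le.1 (abs_dev_le_one k hs hs1 y (t + n))
  have h3 := abs_dev_add_sub_le k hs hs1 y t n
  have h4 : dev k s y (t + n) ^ 2 - dev k s y t ^ 2 ≤
      |dev k s y (t + n) - dev k s y t| * 2 := by
    have : dev k s y (t + n) ^ 2 - dev k s y t ^ 2 =
      (dev k s y (t + n) - dev k s y t) * (dev k s y (t + n) + dev k s y t) := by ring
    rw [this]
    refine (le_abs_self _).trans ?_
    rw [abs_mul]
    refine mul_le_mul_of_nonneg_left ?_ (abs_nonneg _)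
    rw [abs_le]
    constructor <;> linarith
  linarith

theorem sq_dev_succ_le [NeZero b] (k : ℕ) {s : ℝ} (hs : 0 ≤ s) (hs1 : s ≤ 1)
    (y : ℕ → Fin b) (t : ℕ) :
    dev k s y (t + 1) ^ 2 ≤ dev k s y t ^ 2 +
      2 * (1 - (1 - s) / (b : ℝ) ^ k) * dev k s y t *
        ((s - 1) * ((b : ℝ) ^ k)⁻¹ * (s ^ occ k y t (block k y t) - pgf k s y t)) +
      (((b : ℝ) ^ k)⁻¹) ^ 2 := by
  obtain ⟨h1, h2⟩ := ratio_mem (b := b) k hs hs1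
  have hq := inv_pow_pos (b := b) k
  have h5 := pow_le_one₀ hs hs1 (n := occ k y t (block k y t))
  have h6 := pow_nonneg hs (occ k y t (block k y t))
  have h7 := pgf_nonneg k hs y t
  have h8 := pgf_le_one k hs hs1 y t
  set ρ := 1 - (1 - s) / (b : ℝ) ^ k with hρ
  set ξ := (s - 1) * ((b : ℝ) ^ k)⁻¹ * (s ^ occ k y t (block k y t) - pgf k s y t) with hξ
  have key : dev k s y (t + 1) = ρ * dev k s y t + ξ := by
    unfold dev
    rw [pgf_succ, ← hρ, hξ, hρ]
    ring
  have hξ2 : ξ ^ 2 ≤ (((b : ℝ) ^ k)⁻¹) ^ 2 := by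
    rw [sq_le_sq, abs_of_pos hq, hξ, mul_comm (s - 1), mul_assoc, abs_mul, abs_of_pos hq, abs_mul]
    refine mul_le_of_le_one_right hq.le (mul_le_one₀ ?_ (abs_nonneg _) ?_) <;> rw [abs_le] <;>
      constructor <;> linarith
  have hρ2 : ρ ^ 2 * dev k s y t ^ 2 ≤ dev k s y t ^ 2 :=
    mul_le_of_le_one_left (sq_nonneg _) (pow_le_one₀ h1 h2)
  rw [key]
  nlinarith

/-- At most one word, written at `t`, repeats the block at an earlier position. -/
theorem card_block_overwrite_eq_le_one (k : ℕ) (y : ℕ → Fin b) {j t : ℕ} (hj : j < t) :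
    (Finset.univ.filter fun v : Fin k → Fin b => block k (overwrite y t v) j = v).card ≤ 1 := by
  rw [Finset.card_le_one]
  intro v hv v' hv'
  simp only [Finset.mem_filter, Finset.mem_univ, true_and] at hv hv'
  have key : ∀ n (hn : n < k), v ⟨n, hn⟩ = v' ⟨n, hn⟩ := by
    intro n
    induction n using Nat.strong_induction_on with
    | _ n ih =>
      intro hn
      rw [← congrFun hv ⟨n, hn⟩, ← congrFun hv' ⟨n, hn⟩]
      simp only [block]
      by_cases h : j + n < t
      · rw [overwrite_of_lt _ _ h, overwrite_of_lt _ _ h]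
      · have : j + n = t + ((⟨j + n - t, by omega⟩ : Fin k) : ℕ) := by simp; omega
        rw [this, overwrite_add, overwrite_add]
        exact ih _ (by omega) _
  funext i
  exact key i i.2

theorem sum_pow_occ_sub_pgf [NeZero b] (k : ℕ) {s : ℝ} (y : ℕ → Fin b) (t : ℕ) :
    ∑ ω : Fin k → Fin b, (s ^ occ k y t ω - pgf k s y t) = 0 := by
  have h := one_le_card_pow (b := b) k
  have hcard : (∑ _ω : Fin k → Fin b, pgf k s y t) = (b : ℝ) ^ k * pgf k s y t := by simp
  rw [Finset.sum_sub_distrib, hcard, pgf, mul_div_cancel₀ _ (by positivity), sub_self]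

theorem abs_pow_sub_pow_add_le {s : ℝ} (hs : 0 ≤ s) (hs1 : s ≤ 1) (m n : ℕ) :
    |s ^ (m + n) - s ^ m| ≤ n := by
  have h1 := pow_le_one₀ hs hs1 (n := m)
  have h2 := pow_nonneg hs m
  have h3 := pow_le_one₀ hs hs1 (n := n)
  have h4 := pow_nonneg hs n
  have h5 := one_add_mul_le_pow (a := s - 1) (by linarith) n
  rw [show s ^ (m + n) - s ^ m = -(s ^ m * (1 - s ^ n)) by ring, abs_neg,
    abs_of_nonneg (mul_nonneg h2 (by linarith))]
  have h6 : (1 : ℝ) - s ^ n ≤ n := by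
    have : (n : ℝ) * (1 - s) ≤ n := mul_le_of_le_one_right (Nat.cast_nonneg n) (by linarith)
    simp only [add_sub_cancel] at h5
    linarith
  nlinarith

/-- Averaging over the block at `τ + k`, the square of the deviation grows by at most
`(6 k + 1) / b ^ (2 k)` in one step. -/
theorem sum_sq_dev_overwrite_le [NeZero b] (k : ℕ) {s : ℝ} (hs : 0 ≤ s) (hs1 : s ≤ 1)
    (y : ℕ → Fin b) (τ : ℕ) :
    ∑ v : Fin k → Fin b, dev k s (overwrite y (τ + k) v) (τ + k + 1) ^ 2 ≤
      ∑ v : Fin k → Fin b, (dev k s (overwrite y (τ + k) v) (τ + k) ^ 2 +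
        (6 * k + 1) * (((b : ℝ) ^ k)⁻¹) ^ 2) := by
  set q := ((b : ℝ) ^ k)⁻¹ with hq_def
  have hq : 0 < q := inv_pow_pos (b := b) k
  have hqb : (b : ℝ) ^ k * q = 1 :=
    mul_inv_cancel₀ (by have := one_le_card_pow (b := b) k; positivity)
  obtain ⟨hρ0, hρ1⟩ := ratio_mem (b := b) k hs hs1
  set ρ := 1 - (1 - s) / (b : ℝ) ^ k
  set a := dev k s y τ
  set g := pgf k s y τ
  have ha := abs_dev_le_one k hs hs1 y τ
  let δ : (Fin k → Fin b) → ℝ := fun v =>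
    ∑ j ∈ Finset.range k, if block k (overwrite y (τ + k) v) (τ + j) = v then (1 : ℝ) else 0
  have hδ : ∑ v, δ v ≤ k := by
    rw [Finset.sum_comm]
    calc _ ≤ ∑ j ∈ Finset.range k, (1 : ℝ) := by
          refine Finset.sum_le_sum fun j hj => ?_
          rw [Finset.sum_boole]
          exact_mod_cast card_block_overwrite_eq_le_one k y
            (show τ + j < τ + k by have := Finset.mem_range.1 hj; omega)
      _ = k := by simp
  have hpt : ∀ v : Fin k → Fin b, dev k s (overwrite y (τ + k) v) (τ + k + 1) ^ 2 ≤
      dev k s (overwrite y (τ + k) v) (τ + k) ^ 2 +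
        2 * ρ * a * (s - 1) * q * (s ^ occ k y τ v - g) + 2 * q * δ v + (4 * k + 1) * q ^ 2 := by
    intro v
    set z := overwrite y (τ + k) v with hz
    have hagree : ∀ n, n + 1 < τ + k → z n = y n := fun n hn =>
      overwrite_of_lt y v (by omega)
    have hblock : block k z (τ + k) = v := block_overwrite k y _ v
    have h1 := sq_dev_succ_le k hs hs1 z (τ + k)
    rw [hblock] at h1
    have hX : |s ^ occ k z (τ + k) v - s ^ occ k y τ v| ≤ δ v := by
      rw [occ_add, occ_congr hagree]
      refine (abs_pow_sub_pow_add_le hs hs1 _ _).trans (le_of_eq ?_)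
      simp only [δ]
      push_cast
      rfl
    have hG : |pgf k s z (τ + k) - g| ≤ k * q := by
      have := abs_pgf_add_sub_le k hs hs1 z τ k
      rwa [pgf_congr hagree] at this
    have hD : |dev k s z (τ + k) - a| ≤ k * q := by
      have := abs_dev_add_sub_le k hs hs1 z τ k
      rwa [dev_congr hagree] at this
    have hX1 := pow_le_one₀ hs hs1 (n := occ k z (τ + k) v)
    have hX0 := pow_nonneg hs (occ k z (τ + k) v)
    have hG0 := pgf_nonneg k hs z (τ + k)
    have hG1 := pgf_le_one k hs hs1 z (τ + k)
    set X := s ^ occ k z (τ + k) v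
    set X' := s ^ occ k y τ v
    set P := pgf k s z (τ + k)
    set d := dev k s z (τ + k)
    have e1 : (d - a) * ((s - 1) * (X - P)) ≤ k * q := by
      refine (le_abs_self _).trans ?_
      rw [abs_mul]
      have : |(s - 1) * (X - P)| ≤ 1 := by
        rw [abs_mul]
        refine mul_le_one₀ ?_ (abs_nonneg _) ?_ <;> rw [abs_le] <;> constructor <;> linarith
      have := mul_le_mul hD this (abs_nonneg _) (by positivity)
      linarith
    have e2 : a * (s - 1) * ((X - X') - (P - g)) ≤ δ v + k * q := by
      refine (le_abs_self _).trans ?_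
      rw [abs_mul]
      have h3 : |a * (s - 1)| ≤ 1 := by
        rw [abs_mul]
        refine mul_le_one₀ ha (abs_nonneg _) ?_
        rw [abs_le]
        constructor <;> linarith
      have h4 : |(X - X') - (P - g)| ≤ δ v + k * q := (abs_sub _ _).trans (add_le_add hX hG)
      have := mul_le_mul h3 h4 (abs_nonneg _) (by norm_num)
      linarith
    have hδ0 : 0 ≤ δ v := (abs_nonneg _).trans hX
    have e3 : d * ((s - 1) * (X - P)) ≤ a * (s - 1) * (X' - g) + (δ v + 2 * (k * q)) := by
      linarith [e1, e2]
    have e4 : 2 * ρ * d * ((s - 1) * q * (X - P)) ≤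
        2 * ρ * a * (s - 1) * q * (X' - g) + 2 * q * (δ v + 2 * (k * q)) := by
      have h5 := mul_le_mul_of_nonneg_left e3 (by positivity : 0 ≤ 2 * ρ * q)
      have h6 : 2 * ρ * q * (δ v + 2 * (k * q)) ≤ 2 * q * (δ v + 2 * (k * q)) :=
        mul_le_mul_of_nonneg_right (by nlinarith) (by positivity)
      linarith
    linarith
  calc _ ≤ ∑ v : Fin k → Fin b, (dev k s (overwrite y (τ + k) v) (τ + k) ^ 2 +
        2 * ρ * a * (s - 1) * q * (s ^ occ k y τ v - g) + 2 * q * δ v + (4 * k + 1) * q ^ 2) :=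
        Finset.sum_le_sum fun v _ => hpt v
    _ ≤ _ := by
      simp only [Finset.sum_add_distrib, ← Finset.mul_sum]
      rw [sum_pow_occ_sub_pgf]
      simp only [Finset.sum_const, Finset.card_univ, Fintype.card_fun, Fintype.card_fin,
        nsmul_eq_mul, Nat.cast_pow]
      have h1 : (b : ℝ) ^ k * q ^ 2 = q := by linear_combination q * hqb
      rw [h1]
      nlinarith

/-- Resampling a block inside a uniformly random word preserves the uniform law. -/
theorem sum_overwrite_overwrite (k : ℕ) (y : ℕ → Fin b) {T L t : ℕ} (hT : T ≤ t)
    (hL : t + k ≤ T + L)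
    (F : (ℕ → Fin b) → ℝ) :
    ∑ u : Fin L → Fin b, ∑ v : Fin k → Fin b, F (overwrite (overwrite y T u) t v) =
      (b : ℝ) ^ k * ∑ u : Fin L → Fin b, F (overwrite y T u) := by
  let e : (Fin L → Fin b) × (Fin k → Fin b) → (Fin L → Fin b) × (Fin k → Fin b) := fun p =>
    (fun i => if h : t ≤ T + i ∧ T + i < t + k then p.2 ⟨T + i - t, by omega⟩ else p.1 i,
      fun j => p.1 ⟨t + j - T, by omega⟩)
  have he : Function.Involutive e := by
    rintro ⟨u, v⟩
    simp only [e, Prod.mk.injEq]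
    constructor
    · funext i
      split_ifs with h
      · congr 1
        ext
        simp only
        omega
      · rfl
    · funext j
      rw [dif_pos (by omega)]
      congr 1
      ext
      simp only
      omega
  have hF : ∀ p : (Fin L → Fin b) × (Fin k → Fin b),
      overwrite (overwrite y T p.1) t p.2 = overwrite y T (e p).1 := by
    rintro ⟨u, v⟩
    funext n
    simp only [overwrite, e]
    by_cases h1 : T ≤ n ∧ n < T + L <;> by_cases h2 : t ≤ n ∧ n < t + k
    · rw [dif_pos h2, dif_pos h1, dif_pos (by omega)]
      congr 1
      ext
      simp only
      omega
    · rw [dif_neg h2, dif_pos h1, dif_pos h1, dif_neg (by omega)]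
    · omega
    · rw [dif_neg h2, dif_neg h1, dif_neg h1]
  rw [← Fintype.sum_prod_type']
  simp_rw [hF]
  have hsum : ∑ p, F (overwrite y T (e p).1) =
      ∑ p : (Fin L → Fin b) × (Fin k → Fin b), F (overwrite y T p.1) :=
    Equiv.sum_comp he.toPerm fun p => F (overwrite y T p.1)
  rw [hsum, Fintype.sum_prod_type]
  simp [Finset.mul_sum]

/-- Some word of length `L` written at `T` increases the deviations on average by little. -/
theorem sum_sq_dev_chunk_le [NeZero b] (k : ℕ) {s : ℝ} (hs : 0 ≤ s) (hs1 : s ≤ 1)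
    (y : ℕ → Fin b) (τ : ℕ) {L : ℕ} (hL : k ≤ L) :
    ∑ u : Fin L → Fin b, dev k s (overwrite y (τ + k) u) (τ + L) ^ 2 ≤
      (b : ℝ) ^ L * (dev k s y τ ^ 2 + (2 * k * ((b : ℝ) ^ k)⁻¹ +
        L * ((6 * k + 1) * (((b : ℝ) ^ k)⁻¹) ^ 2))) := by
  have hagree : ∀ (u : Fin L → Fin b) n, n + 1 < τ + k → overwrite y (τ + k) u n = y n :=
    fun u n hn => overwrite_of_lt y u (by omega)
  have key : ∀ n, n + k ≤ L →
      ∑ u : Fin L → Fin b, dev k s (overwrite y (τ + k) u) (τ + k + n) ^ 2 ≤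
      ∑ u : Fin L → Fin b, (dev k s y τ ^ 2 + (2 * k * ((b : ℝ) ^ k)⁻¹ +
        n * ((6 * k + 1) * (((b : ℝ) ^ k)⁻¹) ^ 2))) := by
    intro n
    induction n with
    | zero =>
      intro _
      refine Finset.sum_le_sum fun u _ => ?_
      have := sq_dev_add_le k hs hs1 (overwrite y (τ + k) u) τ k
      rw [dev_congr (hagree u)] at this
      simpa using this
    | succ n ih =>
      intro hn
      have hpos : (0 : ℝ) < (b : ℝ) ^ k := by linarith [one_le_card_pow (b := b) k]
      have h1 : ∑ u : Fin L → Fin b, dev k s (overwrite y (τ + k) u) (τ + k + (n + 1)) ^ 2 ≤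
          ∑ u : Fin L → Fin b, (dev k s (overwrite y (τ + k) u) (τ + k + n) ^ 2 +
            (6 * k + 1) * (((b : ℝ) ^ k)⁻¹) ^ 2) := by
        refine le_of_mul_le_mul_left ?_ hpos
        rw [← sum_overwrite_overwrite k y (T := τ + k) (t := τ + k + n) (by omega) (by omega)
            (fun z => dev k s z (τ + k + (n + 1)) ^ 2),
          ← sum_overwrite_overwrite k y (T := τ + k) (t := τ + k + n) (by omega) (by omega)
            (fun z => dev k s z (τ + k + n) ^ 2 + (6 * k + 1) * (((b : ℝ) ^ k)⁻¹) ^ 2)]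
        refine Finset.sum_le_sum fun u _ => ?_
        have := sum_sq_dev_overwrite_le k hs hs1 (overwrite y (τ + k) u) (τ + n)
        rw [show τ + n + k = τ + k + n by omega] at this
        exact this
      have h2 := ih (by omega)
      refine h1.trans ?_
      simp only [Finset.sum_add_distrib] at h2 ⊢
      push_cast
      simp only [add_mul, Finset.sum_add_distrib, one_mul] at h2 ⊢
      linarith
  have h := key (L - k) (by omega)
  rw [show τ + k + (L - k) = τ + L by omega] at h
  refine h.trans ?_
  simp only [Finset.sum_const, Finset.card_univ, Fintype.card_fun, Fintype.card_fin,
    nsmul_eq_mul, Nat.cast_pow]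
  refine mul_le_mul_of_nonneg_left ?_ (by positivity)
  have : ((L - k : ℕ) : ℝ) ≤ L := by exact_mod_cast Nat.sub_le _ _
  gcongr

theorem abs_sum_range_sub_tsum_le {p : ℕ → ℝ} (hp : ∀ i, 0 ≤ p i) (hsum : Summable p)
    (hle : ∑' i, p i ≤ 1) {s : ℝ} (hs : 0 ≤ s) (hs1 : s ≤ 1) (n : ℕ) :
    |∑ i ∈ Finset.range n, p i * s ^ i - ∑' i, p i * s ^ i| ≤ s ^ n := by
  have hsum' : Summable fun i => p i * s ^ i :=
    Summable.of_nonneg_of_le (fun i => mul_nonneg (hp i) (pow_nonneg hs i))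
      (fun i => mul_le_of_le_one_right (hp i) (pow_le_one₀ hs hs1)) hsum
  have hshift : Summable fun i => p (i + n) := (summable_nat_add_iff n).2 hsum
  rw [← hsum'.sum_add_tsum_nat_add n, sub_add_cancel_left, abs_neg, abs_of_nonneg
    (tsum_nonneg fun i => mul_nonneg (hp _) (pow_nonneg hs _))]
  have h1 : ∑' i, p (i + n) ≤ 1 := by
    have := hsum.sum_add_tsum_nat_add n
    have h2 : 0 ≤ ∑ i ∈ Finset.range n, p i := Finset.sum_nonneg fun i _ => hp i
    linarith
  calc ∑' i, p (i + n) * s ^ (i + n) ≤ ∑' i, p (i + n) * s ^ n := by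
        refine Summable.tsum_le_tsum (fun i => ?_) ((summable_nat_add_iff n).2 hsum')
          (hshift.mul_right _)
        exact mul_le_mul_of_nonneg_left (pow_le_pow_of_le_one hs hs1 (by omega)) (hp _)
    _ = (∑' i, p (i + n)) * s ^ n := tsum_mul_right
    _ ≤ s ^ n := mul_le_of_le_one_left (pow_nonneg hs n) h1

/-- Convergence of probability generating functions at the points `2 ^ (-m)` implies
convergence of the laws. -/
theorem tendsto_of_tendsto_tsum_pow {p : ℕ → ℕ → ℝ} {P : ℕ → ℝ} (hp : ∀ k i, 0 ≤ p k i)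
    (hps : ∀ k, Summable (p k)) (hp1 : ∀ k, ∑' i, p k i ≤ 1) (hP : ∀ i, 0 ≤ P i)
    (hPs : Summable P) (hP1 : ∑' i, P i ≤ 1)
    (h : ∀ m : ℕ, Tendsto (fun k => ∑' i, p k i * ((1 / 2 : ℝ) ^ m) ^ i) atTop
      (nhds (∑' i, P i * ((1 / 2 : ℝ) ^ m) ^ i))) (i : ℕ) :
    Tendsto (fun k => p k i) atTop (nhds (P i)) := by
  induction i using Nat.strong_induction_on with
  | _ i ih =>
    rw [Metric.tendsto_atTop]
    intro ε hε
    obtain ⟨m, hm⟩ := exists_pow_lt_of_lt_one (show 0 < ε / 3 by positivity)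
      (show (1 / 2 : ℝ) < 1 by norm_num)
    have hs : 0 < (1 / 2 : ℝ) ^ m := by positivity
    have hs1 : (1 / 2 : ℝ) ^ m ≤ 1 := pow_le_one₀ (by norm_num) (by norm_num)
    have hm' := h m
    set s := (1 / 2 : ℝ) ^ m
    have hlim : Tendsto (fun k => (∑' j, p k j * s ^ j) - ∑ j ∈ Finset.range i, p k j * s ^ j)
        atTop (nhds ((∑' j, P j * s ^ j) - ∑ j ∈ Finset.range i, P j * s ^ j)) :=
      hm'.sub (tendsto_finsetSum _ fun j hj =>
        (ih j (Finset.mem_range.1 hj)).mul_const _)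
    obtain ⟨N, hN⟩ := (Metric.tendsto_atTop.1 hlim) (s ^ (i + 1)) (by positivity)
    refine ⟨N, fun k hk => ?_⟩
    have h1 := abs_le.1 (abs_sum_range_sub_tsum_le (hp k) (hps k) (hp1 k) hs.le hs1 (i + 1))
    have h2 := abs_le.1 (abs_sum_range_sub_tsum_le hP hPs hP1 hs.le hs1 (i + 1))
    have h3 := abs_lt.1 (by simpa [Real.dist_eq] using hN k hk)
    rw [Finset.sum_range_succ] at h1 h2
    have h4 : |(p k i - P i) * s ^ i| < 3 * s ^ (i + 1) := by
      rw [abs_lt]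
      constructor <;> linarith
    rw [abs_mul, abs_of_pos (pow_pos hs i), pow_succ] at h4
    rw [Real.dist_eq]
    have h5 : |p k i - P i| < 3 * s := by
      refine lt_of_mul_lt_mul_right ?_ (pow_nonneg hs.le i)
      linarith
    linarith

/-- The proportion of the words of length `k` with exactly `i` occurrences below `t`. -/
noncomputable def occLaw (k : ℕ) (y : ℕ → Fin b) (t i : ℕ) : ℝ :=
  ((Finset.univ.filter fun ω : Fin k → Fin b => occ k y t ω = i).card : ℝ) / (b : ℝ) ^ k

theorem Z_eq_occLaw (k i : ℕ) (lam : ℝ) (x : ℕ → Fin b) :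
    Z b k i lam x = occLaw k x ⌊lam * (b : ℝ) ^ k⌋₊ i := by
  unfold Z occLaw
  congr 3
  refine Finset.filter_congr fun ω _ => ?_
  have : ((Finset.Icc 1 ⌊lam * (b : ℝ) ^ k⌋₊).filter fun j => OccursAt x j ω).card =
      occ k x ⌊lam * (b : ℝ) ^ k⌋₊ ω := by
    symm
    unfold occ
    refine Finset.card_bij (fun j _ => j + 1) ?_ ?_ ?_
    · intro j hj
      simp only [Finset.mem_filter, Finset.mem_range, Finset.mem_Icc] at hj ⊢
      refine ⟨by omega, fun t => ?_⟩
      rw [← hj.2]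
      simp [block]
    · intro j _ j' _ h
      omega
    · intro j hj
      simp only [Finset.mem_filter, Finset.mem_Icc] at hj
      refine ⟨j - 1, ?_, by omega⟩
      simp only [Finset.mem_filter, Finset.mem_range]
      exact ⟨by omega, funext hj.2⟩
  rw [this]

theorem hasSum_occLaw (k : ℕ) (s : ℝ) (y : ℕ → Fin b) (t : ℕ) :
    HasSum (fun i => occLaw k y t i * s ^ i) (pgf k s y t) := by
  have h1 : HasSum (fun i => ∑ ω : Fin k → Fin b, if i = occ k y t ω then s ^ occ k y t ω else 0)
      (∑ ω : Fin k → Fin b, s ^ occ k y t ω) :=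
    hasSum_sum fun ω _ => hasSum_ite_eq _ _
  refine (h1.div_const ((b : ℝ) ^ k)).congr_fun fun i => ?_
  unfold occLaw
  rw [Finset.card_filter]
  push_cast
  rw [div_mul_eq_mul_div, Finset.sum_mul]
  congr 1
  refine Finset.sum_congr rfl fun ω _ => ?_
  by_cases h : occ k y t ω = i
  · simp [h]
  · rw [if_neg h, if_neg (Ne.symm h), zero_mul]

theorem occLaw_nonneg (k : ℕ) (y : ℕ → Fin b) (t i : ℕ) : 0 ≤ occLaw k y t i := by
  unfold occLaw
  positivity

theorem tendsto_card_pow (hb : 2 ≤ b) : Tendsto (fun k : ℕ => (b : ℝ) ^ k) atTop atTop :=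
  tendsto_pow_atTop_atTop_of_one_lt (by exact_mod_cast hb)

theorem tendsto_ratio_pow (hb : 2 ≤ b) {lam : ℝ} (hlam : 0 < lam) {s : ℝ} (hs : 0 ≤ s)
    (hs1 : s ≤ 1) :
    Tendsto (fun k : ℕ => (1 - (1 - s) / (b : ℝ) ^ k) ^ ⌊lam * (b : ℝ) ^ k⌋₊) atTop
      (nhds (Real.exp (-lam * (1 - s)))) := by
  have : NeZero b := ⟨by omega⟩
  have hB := tendsto_card_pow hb
  have h1 : Tendsto (fun k : ℕ => (1 + -(1 - s) / (b : ℝ) ^ k) ^ ((b : ℝ) ^ k)) atTop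
      (nhds (Real.exp (-(1 - s)))) := (Real.tendsto_one_add_div_rpow_exp _).comp hB
  have h2 : Tendsto (fun k : ℕ => (⌊lam * (b : ℝ) ^ k⌋₊ : ℝ) / (b : ℝ) ^ k) atTop (nhds lam) :=
    (tendsto_nat_floor_mul_div_atTop hlam.le).comp hB
  have h3 := h1.rpow h2 (Or.inl (Real.exp_pos _).ne')
  rw [← Real.exp_mul, show -(1 - s) * lam = -lam * (1 - s) by ring] at h3
  refine h3.congr fun k => ?_
  have hpos : (0 : ℝ) < (b : ℝ) ^ k := by linarith [one_le_card_pow (b := b) k]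
  rw [neg_div, ← sub_eq_add_neg, ← Real.rpow_mul (ratio_mem k hs hs1).1,
    mul_div_cancel₀ _ hpos.ne', Real.rpow_natCast]

theorem hasSum_poisson (lam s : ℝ) :
    HasSum (fun i : ℕ => Real.exp (-lam) * lam ^ i / (Nat.factorial i : ℝ) * s ^ i)
      (Real.exp (-lam * (1 - s))) := by
  have h := (NormedSpace.expSeries_div_hasSum_exp (lam * s)).mul_left (Real.exp (-lam))
  rw [← Real.exp_eq_exp_ℝ, ← Real.exp_add] at h
  rw [show -lam + lam * s = -lam * (1 - s) by ring] at h
  refine h.congr_fun fun i => ?_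
  rw [mul_pow]
  ring

/-- A sequence all of whose deviations vanish in the limit is Poisson generic. -/
theorem poissonGeneric_of_tendsto_dev (hb : 2 ≤ b) {x : ℕ → Fin b}
    (hx : ∀ lam : ℝ, 0 < lam → ∀ m : ℕ, Tendsto
      (fun k : ℕ => dev k ((1 / 2 : ℝ) ^ m) x ⌊lam * (b : ℝ) ^ k⌋₊) atTop (nhds 0)) :
    PoissonGeneric b x := by
  have : NeZero b := ⟨by omega⟩
  intro lam hlam i
  simp_rw [Z_eq_occLaw]
  have hP := hasSum_poisson lam 1
  simp only [one_pow, mul_one, sub_self, mul_zero, Real.exp_zero] at hP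
  have hp : ∀ k, HasSum (fun i => occLaw k x ⌊lam * (b : ℝ) ^ k⌋₊ i)
      (pgf k 1 x ⌊lam * (b : ℝ) ^ k⌋₊) := fun k => by
    simpa using hasSum_occLaw k 1 x ⌊lam * (b : ℝ) ^ k⌋₊
  refine tendsto_of_tendsto_tsum_pow (p := fun k i => occLaw k x ⌊lam * (b : ℝ) ^ k⌋₊ i)
    (fun k i => occLaw_nonneg _ _ _ _) (fun k => (hp k).summable)
    (fun k => (hp k).tsum_eq.le.trans (pgf_le_one k zero_le_one le_rfl _ _))
    (P := fun i => Real.exp (-lam) * lam ^ i / (Nat.factorial i : ℝ))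
    (fun i => by positivity) hP.summable hP.tsum_eq.le (fun m => ?_) i
  have hs : 0 ≤ (1 / 2 : ℝ) ^ m := by positivity
  have hs1 : (1 / 2 : ℝ) ^ m ≤ 1 := pow_le_one₀ (by norm_num) (by norm_num)
  simp_rw [(hasSum_occLaw _ _ _ _).tsum_eq]
  rw [(hasSum_poisson lam _).tsum_eq]
  have h := (hx lam hlam m).add (tendsto_ratio_pow hb hlam hs hs1)
  rw [zero_add] at h
  refine h.congr fun k => ?_
  unfold dev
  ring

/-- The deviations of words of length `k` are controlled at the times `c ^ 2 - k` with
`c ≤ horizon b k`. -/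
def horizon (b k : ℕ) : ℕ := k * b ^ ((k + 1) / 2)

/-- The weighted sum of the squared deviations at time `c ^ 2 - k` over the word lengths `k < n`
and the arguments `2 ^ (-m)` with `m < k`. -/
noncomputable def potential (y : ℕ → Fin b) (n c : ℕ) : ℝ :=
  ∑ k ∈ Finset.range n, if c ≤ horizon b k then
    ∑ m ∈ Finset.range k, (k : ℝ) * dev k ((1 / 2 : ℝ) ^ m) y (c ^ 2 - k) ^ 2 else 0

/-- The sequence `x` is greedy from `c₀` on: for `c ≥ c₀`, its block on `[c ^ 2, (c + 1) ^ 2)`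
minimizes the potential, given the symbols preceding it. -/
def Greedy (c₀ : ℕ) (x : ℕ → Fin b) : Prop :=
  ∀ c, c₀ ≤ c → ∀ u : Fin (2 * c + 1) → Fin b,
    potential x c (c + 1) ≤ potential (overwrite x (c ^ 2) u) c (c + 1)

/-- Bound for the mean increase of the term `k` of the potential in the `c`-th step. -/
noncomputable def stepError (b k c : ℕ) : ℝ :=
  if c + 1 ≤ horizon b k then
    (k : ℝ) * k * (2 * k * ((b : ℝ) ^ k)⁻¹ +
      (2 * c + 1) * ((6 * k + 1) * (((b : ℝ) ^ k)⁻¹) ^ 2)) else 0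

theorem potential_congr {y z : ℕ → Fin b} {n c : ℕ} (hn : n ≤ c)
    (h : ∀ i, i < c ^ 2 → y i = z i) : potential y n c = potential z n c := by
  unfold potential
  refine Finset.sum_congr rfl fun k hk => ?_
  have hkc : k ≤ c ^ 2 := by
    have := Finset.mem_range.1 hk
    nlinarith
  congr 1
  refine Finset.sum_congr rfl fun m _ => ?_
  rw [dev_congr fun i hi => h i (by omega)]

theorem half_pow_mem (m : ℕ) : 0 ≤ (1 / 2 : ℝ) ^ m ∧ (1 / 2 : ℝ) ^ m ≤ 1 :=
  ⟨by positivity, pow_le_one₀ (by norm_num) (by norm_num)⟩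

theorem sum_potential_overwrite_le [NeZero b] (y : ℕ → Fin b) (c : ℕ) :
    ∑ u : Fin (2 * c + 1) → Fin b, potential (overwrite y (c ^ 2) u) c (c + 1) ≤
      ∑ _u : Fin (2 * c + 1) → Fin b,
        (potential y c c + ∑ k ∈ Finset.range c, stepError b k c) := by
  unfold potential
  rw [Finset.sum_comm]
  simp only [Finset.sum_const, Finset.card_univ, Fintype.card_fun, Fintype.card_fin,
    nsmul_eq_mul, Nat.cast_pow]
  rw [← Finset.sum_add_distrib, Finset.mul_sum]
  refine Finset.sum_le_sum fun k hk => ?_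
  have hkc := Finset.mem_range.1 hk
  have hkc2 : k ≤ c ^ 2 := by nlinarith
  unfold stepError
  by_cases h : c + 1 ≤ horizon b k
  · simp only [if_pos h, if_pos (show c ≤ horizon b k by omega)]
    rw [Finset.sum_comm]
    have hm : ∀ m ∈ Finset.range k, ∑ u : Fin (2 * c + 1) → Fin b,
        (k : ℝ) * dev k ((1 / 2 : ℝ) ^ m) (overwrite y (c ^ 2) u) ((c + 1) ^ 2 - k) ^ 2 ≤
        (b : ℝ) ^ (2 * c + 1) * (k * dev k ((1 / 2 : ℝ) ^ m) y (c ^ 2 - k) ^ 2 +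
          k * (2 * k * ((b : ℝ) ^ k)⁻¹ +
            (2 * c + 1) * ((6 * k + 1) * (((b : ℝ) ^ k)⁻¹) ^ 2))) := by
      intro m _
      have := sum_sq_dev_chunk_le k (half_pow_mem m).1 (half_pow_mem m).2 y (c ^ 2 - k)
        (L := 2 * c + 1) (by omega)
      rw [show c ^ 2 - k + k = c ^ 2 by omega,
        show c ^ 2 - k + (2 * c + 1) = (c + 1) ^ 2 - k by
          rw [show (c + 1) ^ 2 = c ^ 2 + (2 * c + 1) by ring]; omega] at this
      rw [← Finset.mul_sum]
      have h2 := mul_le_mul_of_nonneg_left this (Nat.cast_nonneg (α := ℝ) k)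
      push_cast at h2
      linarith
    refine (Finset.sum_le_sum hm).trans (le_of_eq ?_)
    rw [← Finset.mul_sum, Finset.sum_add_distrib]
    simp only [Finset.sum_const, Finset.card_range, nsmul_eq_mul]
    ring
  · simp only [if_neg h, Finset.sum_const_zero, add_zero]
    refine mul_nonneg (by positivity) ?_
    split_ifs
    · exact Finset.sum_nonneg fun m _ => by positivity
    · exact le_rfl

theorem Greedy.potential_succ_le [NeZero b] {c₀ : ℕ} {x : ℕ → Fin b} (hx : Greedy c₀ x) {c : ℕ}
    (hc : c₀ ≤ c) :
    potential x c (c + 1) ≤ potential x c c + ∑ k ∈ Finset.range c, stepError b k c := by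
  obtain ⟨u, -, hu⟩ := Finset.exists_le_of_sum_le Finset.univ_nonempty
    (sum_potential_overwrite_le x c)
  exact (hx c hc u).trans hu

theorem half_pow_half_le (k : ℕ) : (1 / 2 : ℝ) ^ (k / 2) ≤ 2 * (3 / 4) ^ k := by
  induction k using Nat.twoStepInduction with
  | zero => norm_num
  | one => norm_num
  | more k ih _ =>
    rw [show (k + 2) / 2 = k / 2 + 1 by omega, pow_succ, pow_add]
    have : (0 : ℝ) < (3 / 4) ^ k := by positivity
    nlinarith

theorem inv_pow_le_geometric (hb : 2 ≤ b) (k : ℕ) : ((b : ℝ) ^ k)⁻¹ ≤ (3 / 4) ^ k := by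
  rw [← inv_pow]
  refine pow_le_pow_left₀ (by positivity) ?_ k
  have : (2 : ℝ) ≤ b := by exact_mod_cast hb
  calc (b : ℝ)⁻¹ ≤ 2⁻¹ := inv_anti₀ (by norm_num) this
    _ ≤ 3 / 4 := by norm_num

theorem horizon_mul_inv_pow_le (hb : 2 ≤ b) (k : ℕ) :
    horizon b k * ((b : ℝ) ^ k)⁻¹ ≤ 2 * k * (3 / 4) ^ k := by
  have hb' : (2 : ℝ) ≤ b := by exact_mod_cast hb
  have hb0 : (b : ℝ) ≠ 0 := by positivity
  have h1 : (b : ℝ) ^ ((k + 1) / 2) * ((b : ℝ) ^ k)⁻¹ = (b : ℝ)⁻¹ ^ (k / 2) := by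
    have : (b : ℝ) ^ k = (b : ℝ) ^ ((k + 1) / 2) * (b : ℝ) ^ (k / 2) := by
      rw [← pow_add]
      congr 1
      omega
    rw [this, inv_pow]
    field_simp
  have h2 : (b : ℝ)⁻¹ ^ (k / 2) ≤ (1 / 2 : ℝ) ^ (k / 2) := by
    refine pow_le_pow_left₀ (by positivity) ?_ _
    rw [one_div]
    exact inv_anti₀ (by norm_num) hb'
  unfold horizon
  push_cast
  rw [mul_assoc, h1]
  have := mul_le_mul_of_nonneg_left (h2.trans (half_pow_half_le k)) (Nat.cast_nonneg (α := ℝ) k)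
  linarith

theorem sum_stepError_le (b k n : ℕ) :
    ∑ c ∈ Finset.range n, stepError b k c ≤
      (k : ℝ) * k * (2 * k * (horizon b k * ((b : ℝ) ^ k)⁻¹) +
        (6 * k + 1) * (horizon b k * ((b : ℝ) ^ k)⁻¹) ^ 2) := by
  set q := ((b : ℝ) ^ k)⁻¹
  have hq : 0 ≤ q := by positivity
  have hsum : ∀ H : ℕ, ∑ c ∈ Finset.range H, (k : ℝ) * k * (2 * k * q +
      (2 * c + 1) * ((6 * k + 1) * q ^ 2)) =
      k * k * (2 * k * (H * q) + (6 * k + 1) * (H * q) ^ 2) := by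
    intro H
    induction H with
    | zero => simp
    | succ H ih =>
      rw [Finset.sum_range_succ, ih]
      push_cast
      ring
  rw [← hsum]
  unfold stepError
  rw [← Finset.sum_filter]
  refine Finset.sum_le_sum_of_subset_of_nonneg (fun c hc => ?_) fun c _ _ => by positivity
  simp only [Finset.mem_filter, Finset.mem_range] at hc ⊢
  omega

/-- Bound for the first contribution of the term `k` to the potential. -/
noncomputable def entryError (b k : ℕ) : ℝ :=
  (k : ℝ) * k * (((k + 1) ^ 2 : ℝ) * ((b : ℝ) ^ k)⁻¹) ^ 2

theorem potential_succ_self_le [NeZero b] (x : ℕ → Fin b) (c : ℕ) :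
    potential x (c + 1) (c + 1) ≤ potential x c (c + 1) + entryError b c := by
  have hterm : ∀ m ∈ Finset.range c,
      (c : ℝ) * dev c ((1 / 2 : ℝ) ^ m) x ((c + 1) ^ 2 - c) ^ 2 ≤
        c * (((c + 1) ^ 2 : ℝ) * ((b : ℝ) ^ c)⁻¹) ^ 2 := by
    intro m _
    have h := abs_dev_add_sub_le c (half_pow_mem m).1 (half_pow_mem m).2 x 0 ((c + 1) ^ 2 - c)
    rw [zero_add, dev_zero, sub_zero] at h
    have h1 : (((c + 1) ^ 2 - c : ℕ) : ℝ) ≤ (c + 1) ^ 2 := by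
      exact_mod_cast Nat.sub_le _ _
    refine mul_le_mul_of_nonneg_left ?_ (Nat.cast_nonneg _)
    rw [sq_le_sq]
    refine h.trans ((mul_le_mul_of_nonneg_right h1 (by positivity)).trans (le_abs_self _))
  unfold potential
  rw [Finset.sum_range_succ]
  gcongr
  split_ifs
  · refine (Finset.sum_le_sum hterm).trans (le_of_eq ?_)
    rw [entryError]
    simp only [Finset.sum_const, Finset.card_range, nsmul_eq_mul]
    ring
  · unfold entryError
    positivity

theorem error_le (hb : 2 ≤ b) (k n : ℕ) :
    ∑ c ∈ Finset.range n, stepError b k c + entryError b k ≤ 48 * ((k : ℝ) ^ 6 * (3 / 4) ^ k) := by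
  refine (add_le_add_left (sum_stepError_le b k n) _).trans ?_
  unfold entryError
  rcases Nat.eq_zero_or_pos k with rfl | hk
  · simp
  have hK : (1 : ℝ) ≤ k := by exact_mod_cast hk
  have hH := horizon_mul_inv_pow_le hb k
  have hq := inv_pow_le_geometric hb k
  have hH0 : 0 ≤ horizon b k * ((b : ℝ) ^ k)⁻¹ := by positivity
  have hq0 : 0 ≤ ((b : ℝ) ^ k)⁻¹ := by positivity
  generalize horizon b k * ((b : ℝ) ^ k)⁻¹ = h at *
  generalize ((b : ℝ) ^ k)⁻¹ = q at *
  have hφ0 : (0 : ℝ) < (3 / 4) ^ k := by positivity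
  have hφ1 : (3 / 4 : ℝ) ^ k ≤ 1 := pow_le_one₀ (by norm_num) (by norm_num)
  generalize (3 / 4 : ℝ) ^ k = φ at *
  have hφ2 : φ ^ 2 ≤ φ := by nlinarith
  generalize (k : ℝ) = K at *
  have h2 : h ^ 2 ≤ 4 * K ^ 2 * φ := by
    calc h ^ 2 ≤ (2 * K * φ) ^ 2 := pow_le_pow_left₀ hH0 hH 2
      _ = 4 * K ^ 2 * φ ^ 2 := by ring
      _ ≤ 4 * K ^ 2 * φ := by gcongr
  have h3 : ((K + 1) ^ 2 * q) ^ 2 ≤ 16 * K ^ 4 * φ := by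
    calc ((K + 1) ^ 2 * q) ^ 2 ≤ ((2 * K) ^ 2 * φ) ^ 2 := by
          gcongr
          linarith
      _ = 16 * K ^ 4 * φ ^ 2 := by ring
      _ ≤ 16 * K ^ 4 * φ := by gcongr
  calc K * K * (2 * K * h + (6 * K + 1) * h ^ 2) + K * K * ((K + 1) ^ 2 * q) ^ 2
      ≤ K * K * (2 * K * (2 * K * φ) + (7 * K) * (4 * K ^ 2 * φ)) +
        K * K * (16 * K ^ 4 * φ) := by
        gcongr
        linarith
    _ = (4 * K ^ 4 + 28 * K ^ 5 + 16 * K ^ 6) * φ := by ring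
    _ ≤ (4 * K ^ 6 + 28 * K ^ 6 + 16 * K ^ 6) * φ := by
        have h4 : K ^ 4 ≤ K ^ 6 := pow_le_pow_right₀ hK (by norm_num)
        have h5 : K ^ 5 ≤ K ^ 6 := pow_le_pow_right₀ hK (by norm_num)
        refine mul_le_mul_of_nonneg_right ?_ hφ0.le
        linarith
    _ = 48 * (K ^ 6 * φ) := by ring

theorem stepError_nonneg (b k c : ℕ) : 0 ≤ stepError b k c := by
  unfold stepError
  split_ifs <;> positivity

/-- The potential of a greedy sequence stays bounded. -/
theorem Greedy.exists_potential_le (hb : 2 ≤ b) {c₀ : ℕ} {x : ℕ → Fin b} (hx : Greedy c₀ x) :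
    ∃ C, 0 ≤ C ∧ ∀ c, c₀ ≤ c → potential x c c ≤ C := by
  have : NeZero b := ⟨by omega⟩
  have hsummable : Summable fun k : ℕ => 48 * ((k : ℝ) ^ 6 * (3 / 4 : ℝ) ^ k) :=
    (summable_pow_mul_geometric_of_norm_lt_one 6
      (show ‖(3 / 4 : ℝ)‖ < 1 by norm_num)).mul_left 48
  have hstep : ∀ n, potential x (c₀ + n) (c₀ + n) ≤ potential x c₀ c₀ +
      ∑ c ∈ Finset.range (c₀ + n), (entryError b c + ∑ k ∈ Finset.range c, stepError b k c) := by
    intro n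
    induction n with
    | zero =>
      refine le_add_of_nonneg_right (Finset.sum_nonneg fun c _ => add_nonneg ?_ ?_)
      · unfold entryError
        positivity
      · exact Finset.sum_nonneg fun k _ => stepError_nonneg _ _ _
    | succ n ih =>
      rw [← add_assoc, Finset.sum_range_succ]
      have h1 := potential_succ_self_le x (c₀ + n)
      have h2 := hx.potential_succ_le (c := c₀ + n) (by omega)
      linarith
  have hnonneg : 0 ≤ potential x c₀ c₀ := by
    unfold potential
    refine Finset.sum_nonneg fun k _ => ?_
    split_ifs
    · exact Finset.sum_nonneg fun m _ => by positivity
    · exact le_rfl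
  refine ⟨potential x c₀ c₀ + ∑' k : ℕ, 48 * ((k : ℝ) ^ 6 * (3 / 4 : ℝ) ^ k),
    add_nonneg hnonneg (tsum_nonneg fun k => by positivity), fun c hc => ?_⟩
  obtain ⟨n, rfl⟩ := Nat.exists_eq_add_of_le hc
  refine (hstep n).trans ?_
  gcongr
  calc ∑ c ∈ Finset.range (c₀ + n), (entryError b c + ∑ k ∈ Finset.range c, stepError b k c)
      ≤ ∑ c ∈ Finset.range (c₀ + n),
          (entryError b c + ∑ k ∈ Finset.range (c₀ + n), stepError b k c) := by
        refine Finset.sum_le_sum fun c hc => (add_le_add_iff_left _).2 ?_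
        refine Finset.sum_le_sum_of_subset_of_nonneg ?_ fun k _ _ => stepError_nonneg _ _ _
        exact Finset.range_mono (Finset.mem_range.1 hc).le
    _ = ∑ k ∈ Finset.range (c₀ + n),
          (∑ c ∈ Finset.range (c₀ + n), stepError b k c + entryError b k) := by
        rw [Finset.sum_add_distrib, Finset.sum_add_distrib, add_comm]
        congr 1
        exact Finset.sum_comm
    _ ≤ ∑ k ∈ Finset.range (c₀ + n), 48 * ((k : ℝ) ^ 6 * (3 / 4 : ℝ) ^ k) :=
        Finset.sum_le_sum fun k _ => error_le hb k _
    _ ≤ _ := hsummable.sum_le_tsum _ fun k _ => by positivity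

theorem mul_sq_dev_le_potential (x : ℕ → Fin b) {k m c : ℕ} (hm : m < k) (hk : k < c)
    (hc : c ≤ horizon b k) :
    (k : ℝ) * dev k ((1 / 2 : ℝ) ^ m) x (c ^ 2 - k) ^ 2 ≤ potential x c c := by
  have h1 : (k : ℝ) * dev k ((1 / 2 : ℝ) ^ m) x (c ^ 2 - k) ^ 2 ≤
      ∑ m ∈ Finset.range k, (k : ℝ) * dev k ((1 / 2 : ℝ) ^ m) x (c ^ 2 - k) ^ 2 :=
    Finset.single_le_sum (f := fun m => (k : ℝ) * dev k ((1 / 2 : ℝ) ^ m) x (c ^ 2 - k) ^ 2)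
      (fun m _ => by positivity) (Finset.mem_range.2 hm)
  have h2 := Finset.single_le_sum (f := fun k => if c ≤ horizon b k then
    ∑ m ∈ Finset.range k, (k : ℝ) * dev k ((1 / 2 : ℝ) ^ m) x (c ^ 2 - k) ^ 2 else 0)
      (fun k _ => by
        split_ifs
        · exact Finset.sum_nonneg fun m _ => by positivity
        · exact le_rfl) (Finset.mem_range.2 hk)
  simp only [if_pos hc] at h2
  exact h1.trans h2

theorem Greedy.poissonGeneric (hb : 2 ≤ b) {c₀ : ℕ} {x : ℕ → Fin b} (hx : Greedy c₀ x) :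
    PoissonGeneric b x := by
  have : NeZero b := ⟨by omega⟩
  obtain ⟨C, hC0, hC⟩ := hx.exists_potential_le hb
  refine poissonGeneric_of_tendsto_dev hb fun lam hlam m => ?_
  have hbound : ∀ᶠ k : ℕ in atTop, |dev k ((1 / 2 : ℝ) ^ m) x ⌊lam * (b : ℝ) ^ k⌋₊| ≤
      √(C / k) + 5 * ((k : ℝ) ^ 1 * (3 / 4) ^ k) := by
    have hgrow : ∀ᶠ k : ℕ in atTop, (k : ℝ) ^ 2 / 2 ^ k < lam / 4 :=
      (tendsto_pow_const_div_const_pow_of_one_lt 2 (by norm_num : (1 : ℝ) < 2)).eventually_lt_const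
        (by positivity)
    filter_upwards [hgrow, eventually_gt_atTop m, eventually_ge_atTop (c₀ + 1),
      eventually_ge_atTop ⌈lam⌉₊] with k hk1 hk2 hk3 hk4
    have hbk : (2 : ℝ) ^ k ≤ (b : ℝ) ^ k :=
      pow_le_pow_left₀ (by norm_num) (by exact_mod_cast hb) k
    set N := ⌊lam * (b : ℝ) ^ k⌋₊ with hN
    set c := Nat.sqrt N with hc_def
    have hkc : 2 * k ≤ c := by
      rw [hc_def, Nat.le_sqrt, hN, Nat.le_floor_iff (by positivity)]
      rw [div_lt_iff₀ (by positivity)] at hk1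
      push_cast
      nlinarith
    have hcN : c * c ≤ N := Nat.sqrt_le N
    have hNc : N < (c + 1) * (c + 1) := Nat.lt_succ_sqrt N
    have hcH : c ≤ horizon b k := by
      rw [← Nat.pow_le_pow_iff_left (two_ne_zero)]
      have h1 : (N : ℝ) ≤ lam * (b : ℝ) ^ k := Nat.floor_le (by positivity)
      have h2 : lam ≤ k := (Nat.le_ceil lam).trans (by exact_mod_cast hk4)
      have hk0 : 1 ≤ k := by omega
      have h3 : N ≤ k * b ^ k := by
        have : (N : ℝ) ≤ k * (b : ℝ) ^ k := h1.trans (by gcongr)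
        exact_mod_cast this
      calc c ^ 2 = c * c := sq c
        _ ≤ k * b ^ k := hcN.trans h3
        _ ≤ k ^ 2 * b ^ (2 * ((k + 1) / 2)) := by
            gcongr
            · nlinarith
            · omega
            · omega
        _ = horizon b k ^ 2 := by
            rw [horizon, mul_pow, ← pow_mul, mul_comm 2]
    have h1 := (mul_sq_dev_le_potential x hk2 (c := c) (by omega) hcH).trans (hC c (by omega))
    have hkpos : (0 : ℝ) < k := by exact_mod_cast (by omega : 0 < k)
    have h2 : |dev k ((1 / 2 : ℝ) ^ m) x (c ^ 2 - k)| ≤ √(C / k) := by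
      refine Real.abs_le_sqrt ?_
      rw [le_div_iff₀ hkpos]
      linarith
    have hkc2 : k ≤ c ^ 2 := by nlinarith
    have h3 := abs_dev_add_sub_le k (half_pow_mem m).1 (half_pow_mem m).2 x (c ^ 2 - k)
      (N - (c ^ 2 - k))
    rw [show c ^ 2 - k + (N - (c ^ 2 - k)) = N by
      have : c ^ 2 ≤ N := by rw [sq]; exact hcN
      omega] at h3
    have h4 : ((N - (c ^ 2 - k) : ℕ) : ℝ) ≤ 2 * horizon b k + k := by
      have : N - (c ^ 2 - k) ≤ 2 * horizon b k + k := by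
        have : (c + 1) * (c + 1) = c ^ 2 + 2 * c + 1 := by ring
        omega
      exact_mod_cast this
    have h5 := horizon_mul_inv_pow_le hb k
    have h6 := inv_pow_le_geometric hb k
    have h7 : ((N - (c ^ 2 - k) : ℕ) : ℝ) * ((b : ℝ) ^ k)⁻¹ ≤ 5 * (k * (3 / 4) ^ k) := by
      refine (mul_le_mul_of_nonneg_right h4 (by positivity)).trans ?_
      have := mul_le_mul_of_nonneg_left h6 hkpos.le
      rw [add_mul]
      linarith
    have h8 := abs_sub_abs_le_abs_sub (dev k ((1 / 2 : ℝ) ^ m) x N)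
      (dev k ((1 / 2 : ℝ) ^ m) x (c ^ 2 - k))
    rw [pow_one]
    linarith
  have hlim : Tendsto (fun k : ℕ => √(C / k) + 5 * ((k : ℝ) ^ 1 * (3 / 4 : ℝ) ^ k)) atTop
      (nhds 0) := by
    have h1 : Tendsto (fun k : ℕ => √(C / k)) atTop (nhds 0) := by
      have := (tendsto_const_div_atTop_nhds_zero_nat C).sqrt
      rwa [Real.sqrt_zero] at this
    have h2 := (tendsto_pow_const_mul_const_pow_of_abs_lt_one 1
      (show |(3 / 4 : ℝ)| < 1 by rw [abs_of_pos] <;> norm_num)).const_mul 5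
    simpa using h1.add h2
  exact squeeze_zero_norm' hbound hlim

section Primrec

variable {α : Type*} [Primcodable α]

theorem primrec_natPow {f g : α → ℕ} (hf : Primrec f) (hg : Primrec g) :
    Primrec fun a => f a ^ g a :=
  (Primrec₂.unpaired'.1 Nat.Primrec.pow : Primrec₂ fun m n : ℕ => m ^ n).comp hf hg

theorem primrec_sum_range {f : α → ℕ} {g : α → ℕ → ℕ} (hf : Primrec f) (hg : Primrec₂ g) :
    Primrec fun a => ∑ i ∈ Finset.range (f a), g a i := by
  have h : Primrec₂ fun (a : α) (p : ℕ × ℕ) => p.2 + g a p.1 :=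
    Primrec.nat_add.comp (Primrec.snd.comp Primrec.snd)
      (hg.comp Primrec.fst (Primrec.fst.comp Primrec.snd))
  refine (Primrec.nat_rec' hf (Primrec.const 0) h).of_eq fun a => ?_
  induction f a with
  | zero => rfl
  | succ n ih => rw [Finset.sum_range_succ, ← ih]

/-- The least minimizer of `f` on `{0, …, n - 1}`, for positive `n`. -/
def argminBelow (f : ℕ → ℕ) : ℕ → ℕ
  | 0 => 0
  | n + 1 => if f n < f (argminBelow f n) then n else argminBelow f n

theorem argminBelow_lt (f : ℕ → ℕ) {n : ℕ} (hn : 0 < n) : argminBelow f n < n := by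
  induction n with
  | zero => omega
  | succ n ih =>
    rw [argminBelow]
    split_ifs
    · omega
    · rcases Nat.eq_zero_or_pos n with rfl | h
      · simp [argminBelow]
      · have := ih h
        omega

theorem apply_argminBelow_le (f : ℕ → ℕ) {i n : ℕ} (hi : i < n) : f (argminBelow f n) ≤ f i := by
  induction n with
  | zero => omega
  | succ n ih =>
    rw [argminBelow]
    rcases Nat.lt_succ_iff_lt_or_eq.1 hi with h | rfl
    · have := ih h
      split_ifs <;> omega
    · split_ifs <;> omega

theorem primrec_argminBelow {f : α → ℕ} {g : α → ℕ → ℕ} (hf : Primrec f) (hg : Primrec₂ g) :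
    Primrec fun a => argminBelow (g a) (f a) := by
  have h : Primrec₂ fun (a : α) (p : ℕ × ℕ) => if g a p.1 < g a p.2 then p.1 else p.2 := by
    have h1 : Primrec fun q : α × ℕ × ℕ => q.2.1 := Primrec.fst.comp Primrec.snd
    have h2 : Primrec fun q : α × ℕ × ℕ => q.2.2 := Primrec.snd.comp Primrec.snd
    exact Primrec.ite (Primrec.nat_lt.comp (hg.comp Primrec.fst h1) (hg.comp Primrec.fst h2)) h1 h2
  refine (Primrec.nat_rec' hf (Primrec.const 0) h).of_eq fun a => ?_
  induction f a with
  | zero => rfl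
  | succ n ih => simp only [ih, argminBelow]

end Primrec

/-- The sequence of base `b` digits of `N`, the least significant one first. -/
def digitSeq (b : ℕ) [NeZero b] (N : ℕ) : ℕ → Fin b :=
  fun n => ⟨N / b ^ n % b, Nat.mod_lt _ (NeZero.pos b)⟩

/-- The number of occurrences, at positions below `t` of the digits of `N`, of the word of
length `k` with code `v`. -/
def occCode (b N k t v : ℕ) : ℕ :=
  ∑ j ∈ Finset.range t, if N / b ^ j % b ^ k = v then 1 else 0

/-- The numerator of `pgf k (2 ^ (-m)) (digitSeq b N) t` over the denominator
`b ^ k * (2 ^ m * b ^ k) ^ t`. -/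
def pgfNumerator (b N k m t : ℕ) : ℕ :=
  (b ^ k) ^ t * ∑ v ∈ Finset.range (b ^ k), (2 ^ m) ^ (t - occCode b N k t v)

/-- The numerator of `(1 - (1 - 2 ^ (-m)) / b ^ k) ^ t` over the denominator
`b ^ k * (2 ^ m * b ^ k) ^ t`. -/
def binomialNumerator (b k m t : ℕ) : ℕ :=
  b ^ k * (2 ^ m * b ^ k - 2 ^ m + 1) ^ t

/-- The absolute deviation of the digits of `N`, scaled by `(b * 2) ^ X`. -/
def devCode (b N k m t X : ℕ) : ℕ :=
  (b * 2) ^ X / (b ^ k * (2 ^ m * b ^ k) ^ t) *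
    ((pgfNumerator b N k m t - binomialNumerator b k m t) +
      (binomialNumerator b k m t - pgfNumerator b N k m t))

/-- The potential of the digits of `N` after the `c`-th step, scaled by an integer. -/
def potentialCode (b c N : ℕ) : ℕ :=
  ∑ k ∈ Finset.range c, if c + 1 ≤ horizon b k then
    ∑ m ∈ Finset.range k, k * devCode b N k m ((c + 1) ^ 2 - k) ((c + 1) ^ 3) ^ 2 else 0

section Primrec

variable {α : Type*} [Primcodable α]

theorem primrec_occCode (b : ℕ) {N k t v : α → ℕ} (hN : Primrec N) (hk : Primrec k)
    (ht : Primrec t) (hv : Primrec v) :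
    Primrec fun a => occCode b (N a) (k a) (t a) (v a) := by
  refine primrec_sum_range ht (Primrec.ite (Primrec.eq.comp ?_ (hv.comp Primrec.fst))
    (Primrec.const 1) (Primrec.const 0))
  exact Primrec.nat_mod.comp
    (Primrec.nat_div.comp (hN.comp Primrec.fst) (primrec_natPow (Primrec.const b) Primrec.snd))
    (primrec_natPow (Primrec.const b) (hk.comp Primrec.fst))

theorem primrec_pgfNumerator (b : ℕ) {N k m t : α → ℕ} (hN : Primrec N) (hk : Primrec k)
    (hm : Primrec m) (ht : Primrec t) :
    Primrec fun a => pgfNumerator b (N a) (k a) (m a) (t a) := by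
  have hbk := primrec_natPow (Primrec.const b) hk
  refine Primrec.nat_mul.comp (primrec_natPow hbk ht) (primrec_sum_range hbk ?_)
  exact primrec_natPow (primrec_natPow (Primrec.const 2) (hm.comp Primrec.fst))
    (Primrec.nat_sub.comp (ht.comp Primrec.fst) (primrec_occCode b (hN.comp Primrec.fst)
      (hk.comp Primrec.fst) (ht.comp Primrec.fst) Primrec.snd))

theorem primrec_binomialNumerator (b : ℕ) {k m t : α → ℕ} (hk : Primrec k) (hm : Primrec m)
    (ht : Primrec t) : Primrec fun a => binomialNumerator b (k a) (m a) (t a) := by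
  have hbk := primrec_natPow (Primrec.const b) hk
  have h2m := primrec_natPow (Primrec.const 2) hm
  exact Primrec.nat_mul.comp hbk (primrec_natPow (Primrec.nat_add.comp
    (Primrec.nat_sub.comp (Primrec.nat_mul.comp h2m hbk) h2m) (Primrec.const 1)) ht)

theorem primrec_devCode (b : ℕ) {N k m t X : α → ℕ} (hN : Primrec N) (hk : Primrec k)
    (hm : Primrec m) (ht : Primrec t) (hX : Primrec X) :
    Primrec fun a => devCode b (N a) (k a) (m a) (t a) (X a) := by
  have hbk := primrec_natPow (Primrec.const b) hk
  have h2m := primrec_natPow (Primrec.const 2) hm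
  have hP := primrec_pgfNumerator b hN hk hm ht
  have hQ := primrec_binomialNumerator b hk hm ht
  exact Primrec.nat_mul.comp
    (Primrec.nat_div.comp (primrec_natPow (Primrec.const (b * 2)) hX)
      (Primrec.nat_mul.comp hbk (primrec_natPow (Primrec.nat_mul.comp h2m hbk) ht)))
    (Primrec.nat_add.comp (Primrec.nat_sub.comp hP hQ) (Primrec.nat_sub.comp hQ hP))

theorem primrec_horizon (b : ℕ) : Primrec (horizon b) :=
  Primrec.nat_mul.comp Primrec.id (primrec_natPow (Primrec.const b)
    (Primrec.nat_div.comp (Primrec.nat_add.comp Primrec.id (Primrec.const 1)) (Primrec.const 2)))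

theorem primrec_potentialCode (b : ℕ) {c N : α → ℕ} (hc : Primrec c) (hN : Primrec N) :
    Primrec fun a => potentialCode b (c a) (N a) := by
  have hc1 : Primrec fun a => c a + 1 := Primrec.nat_add.comp hc (Primrec.const 1)
  refine primrec_sum_range hc (Primrec.ite
    (Primrec.nat_le.comp (hc1.comp Primrec.fst) ((primrec_horizon b).comp Primrec.snd))
    (primrec_sum_range Primrec.snd ?_) (Primrec.const 0))
  have hk : Primrec fun p : (α × ℕ) × ℕ => p.1.2 := Primrec.snd.comp Primrec.fst
  have ha : Primrec fun p : (α × ℕ) × ℕ => p.1.1 := Primrec.fst.comp Primrec.fst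
  refine Primrec.nat_mul.comp hk (primrec_natPow ?_ (Primrec.const 2))
  exact primrec_devCode b (hN.comp ha) hk Primrec.snd
    (Primrec.nat_sub.comp (primrec_natPow (hc1.comp ha) (Primrec.const 2)) hk)
    (primrec_natPow (hc1.comp ha) (Primrec.const 3))

end Primrec

theorem mod_pow_div_pow_mod (b N : ℕ) {n k : ℕ} (h : n < k) :
    N % b ^ k / b ^ n % b = N / b ^ n % b := by
  rw [← Nat.add_sub_cancel' h.le, pow_add, Nat.mod_mul_right_div_self]
  exact Nat.mod_mod_of_dvd _ (dvd_pow_self b (by omega))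

theorem block_digitSeq_eq_iff [NeZero b] (N k j : ℕ) (ω : Fin k → Fin b) :
    block k (digitSeq b N) j = ω ↔ N / b ^ j % b ^ k = (finFunctionFinEquiv ω : ℕ) := by
  have h : block k (digitSeq b N) j =
      finFunctionFinEquiv.symm ⟨N / b ^ j % b ^ k, Nat.mod_lt _ (pow_pos (NeZero.pos b) k)⟩ := by
    funext i
    ext
    rw [finFunctionFinEquiv_symm_apply_val]
    simp only [block, digitSeq]
    rw [mod_pow_div_pow_mod _ _ i.2, Nat.div_div_eq_div_mul, pow_add]
  rw [h, Equiv.symm_apply_eq, Fin.ext_iff]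

theorem occ_digitSeq [NeZero b] (N k t : ℕ) (ω : Fin k → Fin b) :
    occ k (digitSeq b N) t ω = occCode b N k t (finFunctionFinEquiv ω) := by
  unfold occ occCode
  rw [Finset.card_filter]
  simp only [block_digitSeq_eq_iff]

theorem occCode_le (b N k t v : ℕ) : occCode b N k t v ≤ t := by
  unfold occCode
  rw [← Finset.card_filter]
  exact (Finset.card_filter_le _ _).trans (Finset.card_range t).le

theorem pgf_digitSeq [NeZero b] (N k m t : ℕ) :
    pgf k ((1 / 2 : ℝ) ^ m) (digitSeq b N) t =
      pgfNumerator b N k m t / ((b : ℝ) ^ k * (2 ^ m * (b : ℝ) ^ k) ^ t) := by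
  have hb0 : (b : ℝ) ≠ 0 := by exact_mod_cast NeZero.ne b
  unfold pgf pgfNumerator
  have h : ∑ ω : Fin k → Fin b, ((1 / 2 : ℝ) ^ m) ^ occ k (digitSeq b N) t ω =
      ∑ v ∈ Finset.range (b ^ k), ((1 / 2 : ℝ) ^ m) ^ occCode b N k t v := by
    rw [← Fin.sum_univ_eq_sum_range (fun v => ((1 / 2 : ℝ) ^ m) ^ occCode b N k t v)]
    refine Fintype.sum_equiv finFunctionFinEquiv _ _ fun ω => ?_
    rw [occ_digitSeq]
  have h' : ∀ v, ((1 / 2 : ℝ) ^ m) ^ occCode b N k t v =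
      (2 ^ m) ^ (t - occCode b N k t v) / (2 ^ m) ^ t := by
    intro v
    rw [eq_div_iff (by positivity), one_div, inv_pow, inv_pow]
    rw [pow_sub₀ _ (by positivity) (occCode_le b N k t v), mul_comm]
  rw [h]
  simp only [h']
  rw [← Finset.sum_div, mul_pow]
  push_cast
  field_simp

theorem dev_digitSeq [NeZero b] (N k m t : ℕ) :
    dev k ((1 / 2 : ℝ) ^ m) (digitSeq b N) t =
      ((pgfNumerator b N k m t : ℝ) - binomialNumerator b k m t) /
        ((b : ℝ) ^ k * (2 ^ m * (b : ℝ) ^ k) ^ t) := by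
  have hb0 : (b : ℝ) ≠ 0 := by exact_mod_cast NeZero.ne b
  have h : (1 - (1 - (1 / 2 : ℝ) ^ m) / (b : ℝ) ^ k) ^ t =
      binomialNumerator b k m t / ((b : ℝ) ^ k * (2 ^ m * (b : ℝ) ^ k) ^ t) := by
    have hle : 2 ^ m ≤ 2 ^ m * b ^ k := Nat.le_mul_of_pos_right _ (pow_pos (NeZero.pos b) k)
    unfold binomialNumerator
    push_cast [hle]
    rw [mul_div_mul_left _ _ (pow_ne_zero _ hb0), ← div_pow]
    congr 1
    rw [one_div, inv_pow]
    field_simp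
    ring
  rw [dev, pgf_digitSeq, h, sub_div]

theorem devCode_sq [NeZero b] (N k m t X : ℕ) (h1 : k + k * t ≤ X) (h2 : m * t ≤ X) :
    (devCode b N k m t X : ℝ) ^ 2 =
      ((b * 2 : ℝ) ^ X * dev k ((1 / 2 : ℝ) ^ m) (digitSeq b N) t) ^ 2 := by
  have hb0 : (b : ℝ) ≠ 0 := by exact_mod_cast NeZero.ne b
  have hdvd : b ^ k * (2 ^ m * b ^ k) ^ t ∣ (b * 2) ^ X := by
    have : b ^ k * (2 ^ m * b ^ k) ^ t = b ^ (k + k * t) * 2 ^ (m * t) := by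
      rw [mul_pow, ← pow_mul, ← pow_mul, pow_add]
      ring
    rw [this, mul_pow]
    exact mul_dvd_mul (pow_dvd_pow _ h1) (pow_dvd_pow _ h2)
  have habs : ∀ p q : ℕ, (((p - q) + (q - p) : ℕ) : ℝ) ^ 2 = ((p : ℝ) - q) ^ 2 := by
    intro p q
    rcases le_total p q with h | h
    · rw [Nat.sub_eq_zero_of_le h, zero_add, Nat.cast_sub h]
      ring
    · rw [Nat.sub_eq_zero_of_le h, add_zero, Nat.cast_sub h]
  rw [dev_digitSeq, devCode, Nat.cast_mul, mul_pow, habs, Nat.cast_div hdvd]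
  · push_cast
    ring
  · push_cast
    positivity

theorem potentialCode_eq [NeZero b] (c N : ℕ) :
    (potentialCode b c N : ℝ) =
      ((b * 2 : ℝ) ^ (c + 1) ^ 3) ^ 2 * potential (digitSeq b N) c (c + 1) := by
  unfold potentialCode potential
  rw [Finset.mul_sum, Nat.cast_sum]
  refine Finset.sum_congr rfl fun k hk => ?_
  have hkc := Finset.mem_range.1 hk
  split_ifs
  · rw [Finset.mul_sum, Nat.cast_sum]
    refine Finset.sum_congr rfl fun m hm => ?_
    have hmk := Finset.mem_range.1 hm
    have ht : (c + 1) ^ 2 - k ≤ (c + 1) ^ 2 := Nat.sub_le _ _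
    have h1 : k * ((c + 1) ^ 2 - k) ≤ c * (c + 1) ^ 2 := Nat.mul_le_mul hkc.le ht
    have h2 : m * ((c + 1) ^ 2 - k) ≤ c * (c + 1) ^ 2 := Nat.mul_le_mul (by omega) ht
    have h3 : (c + 1) ^ 3 = c * (c + 1) ^ 2 + (c + 1) ^ 2 := by ring
    have h4 : k ≤ (c + 1) ^ 2 := by nlinarith
    rw [Nat.cast_mul, Nat.cast_pow, devCode_sq _ _ _ _ _ (by omega) (by omega)]
    ring
  · simp

theorem potential_digitSeq_le [NeZero b] {c N N' : ℕ}
    (h : potentialCode b c N ≤ potentialCode b c N') :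
    potential (digitSeq b N) c (c + 1) ≤ potential (digitSeq b N') c (c + 1) := by
  have hb0 : (0 : ℝ) < b := by exact_mod_cast NeZero.pos b
  have h' : (potentialCode b c N : ℝ) ≤ potentialCode b c N' := by exact_mod_cast h
  rw [potentialCode_eq, potentialCode_eq] at h'
  exact le_of_mul_le_mul_left h' (by positivity)

/-- The codes of the initial blocks of length `(c₀ + j) ^ 2` of the greedy sequence whose initial
block of length `c₀ ^ 2` has the code `N₀`. -/
def greedyCode (b c₀ N₀ : ℕ) : ℕ → ℕ
  | 0 => N₀
  | j + 1 => greedyCode b c₀ N₀ j + b ^ (c₀ + j) ^ 2 *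
      argminBelow (fun v => potentialCode b (c₀ + j)
        (greedyCode b c₀ N₀ j + b ^ (c₀ + j) ^ 2 * v)) (b ^ (2 * (c₀ + j) + 1))

/-- The greedy sequence whose initial block of length `c₀ ^ 2` has the code `N₀`. -/
def greedySeq (b : ℕ) [NeZero b] (c₀ N₀ : ℕ) : ℕ → Fin b :=
  fun n => digitSeq b (greedyCode b c₀ N₀ (n + 1)) n

theorem primrec_greedyCode (b c₀ N₀ : ℕ) : Primrec (greedyCode b c₀ N₀) := by
  have h : Primrec₂ fun j S : ℕ => S + b ^ (c₀ + j) ^ 2 *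
      argminBelow (fun v => potentialCode b (c₀ + j) (S + b ^ (c₀ + j) ^ 2 * v))
        (b ^ (2 * (c₀ + j) + 1)) := by
    have hc : Primrec fun p : ℕ × ℕ => c₀ + p.1 :=
      Primrec.nat_add.comp (Primrec.const c₀) Primrec.fst
    have hpow : Primrec fun p : ℕ × ℕ => b ^ (c₀ + p.1) ^ 2 :=
      primrec_natPow (Primrec.const b) (primrec_natPow hc (Primrec.const 2))
    refine Primrec.nat_add.comp Primrec.snd (Primrec.nat_mul.comp hpow (primrec_argminBelow ?_ ?_))
    · exact primrec_natPow (Primrec.const b) (Primrec.nat_add.comp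
        (Primrec.nat_mul.comp (Primrec.const 2) hc) (Primrec.const 1))
    · exact primrec_potentialCode b (hc.comp Primrec.fst) (Primrec.nat_add.comp
        (Primrec.snd.comp Primrec.fst) (Primrec.nat_mul.comp (hpow.comp Primrec.fst) Primrec.snd))
  refine (Primrec.nat_rec₁ N₀ h).of_eq fun n => ?_
  induction n with
  | zero => rfl
  | succ n ih => simp only [ih, greedyCode]

theorem computable_greedySeq (b : ℕ) [NeZero b] (c₀ N₀ : ℕ) : Computable (greedySeq b c₀ N₀) := by
  refine (Primrec.fin_val_iff.1 ?_).to_comp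
  exact Primrec.nat_mod.comp (Primrec.nat_div.comp
    ((primrec_greedyCode b c₀ N₀).comp Primrec.succ)
    (primrec_natPow (Primrec.const b) Primrec.id)) (Primrec.const b)

theorem greedyCode_lt [NeZero b] {c₀ N₀ : ℕ} (h₀ : N₀ < b ^ c₀ ^ 2) (j : ℕ) :
    greedyCode b c₀ N₀ j < b ^ (c₀ + j) ^ 2 := by
  induction j with
  | zero => exact h₀
  | succ j ih =>
    rw [greedyCode]
    set v := argminBelow (fun v => potentialCode b (c₀ + j)
        (greedyCode b c₀ N₀ j + b ^ (c₀ + j) ^ 2 * v)) (b ^ (2 * (c₀ + j) + 1))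
    have hv : v + 1 ≤ b ^ (2 * (c₀ + j) + 1) := argminBelow_lt _ (pow_pos (NeZero.pos b) _)
    calc greedyCode b c₀ N₀ j + b ^ (c₀ + j) ^ 2 * v
        < b ^ (c₀ + j) ^ 2 * (v + 1) := by rw [mul_add, mul_one]; omega
      _ ≤ b ^ (c₀ + j) ^ 2 * b ^ (2 * (c₀ + j) + 1) := Nat.mul_le_mul_left _ hv
      _ = b ^ (c₀ + (j + 1)) ^ 2 := by
        rw [← pow_add]
        congr 1
        ring

theorem digitSeq_add_mul_of_lt [NeZero b] (N v : ℕ) {n T : ℕ} (h : n < T) :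
    digitSeq b (N + b ^ T * v) n = digitSeq b N n := by
  ext
  simp only [digitSeq]
  have : b ^ T * v = b ^ n * (b * (b ^ (T - n - 1) * v)) := by
    rw [← mul_assoc, ← mul_assoc, ← pow_succ, ← pow_add]
    congr 2
    omega
  rw [this, Nat.add_mul_div_left _ _ (pow_pos (NeZero.pos b) n), Nat.add_mul_mod_self_left]

theorem digitSeq_add_mul_add [NeZero b] {N T : ℕ} (hN : N < b ^ T) (v i : ℕ) :
    digitSeq b (N + b ^ T * v) (T + i) = digitSeq b v i := by
  ext
  simp only [digitSeq]
  rw [pow_add, ← Nat.div_div_eq_div_mul, Nat.add_mul_div_left _ _ (pow_pos (NeZero.pos b) T),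
    Nat.div_eq_of_lt hN, zero_add]

theorem digitSeq_greedyCode_add [NeZero b] (c₀ N₀ : ℕ) {n j : ℕ} (h : n < (c₀ + j) ^ 2) (i : ℕ) :
    digitSeq b (greedyCode b c₀ N₀ (j + i)) n = digitSeq b (greedyCode b c₀ N₀ j) n := by
  induction i with
  | zero => rfl
  | succ i ih =>
    rw [← add_assoc, greedyCode, digitSeq_add_mul_of_lt _ _ (h.trans_le ?_), ih]
    exact Nat.pow_le_pow_left (by omega) 2

theorem greedySeq_eq [NeZero b] (c₀ N₀ : ℕ) {n j : ℕ} (h : n < (c₀ + j) ^ 2) :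
    greedySeq b c₀ N₀ n = digitSeq b (greedyCode b c₀ N₀ j) n := by
  have h' : n < (c₀ + (n + 1)) ^ 2 :=
    (by omega : n < c₀ + (n + 1)).trans_le (Nat.le_self_pow two_ne_zero _)
  unfold greedySeq
  rcases le_total j (n + 1) with hj | hj
  · obtain ⟨i, hi⟩ := Nat.exists_eq_add_of_le hj
    rw [hi, digitSeq_greedyCode_add c₀ N₀ h]
  · obtain ⟨i, rfl⟩ := Nat.exists_eq_add_of_le hj
    rw [digitSeq_greedyCode_add c₀ N₀ h']

theorem digitSeq_finFunctionFinEquiv [NeZero b] {L : ℕ} (u : Fin L → Fin b) (i : Fin L) :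
    digitSeq b (finFunctionFinEquiv u) i = u i := by
  conv_rhs => rw [← finFunctionFinEquiv.symm_apply_apply u]
  ext
  rw [finFunctionFinEquiv_symm_apply_val]
  rfl

theorem greedy_greedySeq [NeZero b] {c₀ N₀ : ℕ} (h₀ : N₀ < b ^ c₀ ^ 2) :
    Greedy c₀ (greedySeq b c₀ N₀) := by
  intro c hc u
  obtain ⟨j, rfl⟩ := Nat.exists_eq_add_of_le hc
  have h1 : potential (greedySeq b c₀ N₀) (c₀ + j) (c₀ + j + 1) =
      potential (digitSeq b (greedyCode b c₀ N₀ (j + 1))) (c₀ + j) (c₀ + j + 1) :=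
    potential_congr (Nat.le_succ _) fun i hi => greedySeq_eq c₀ N₀ hi
  have h2 : potential (overwrite (greedySeq b c₀ N₀) ((c₀ + j) ^ 2) u) (c₀ + j) (c₀ + j + 1) =
      potential (digitSeq b (greedyCode b c₀ N₀ j + b ^ (c₀ + j) ^ 2 * finFunctionFinEquiv u))
        (c₀ + j) (c₀ + j + 1) := by
    refine potential_congr (Nat.le_succ _) fun i hi => ?_
    rcases lt_or_ge i ((c₀ + j) ^ 2) with h | h
    · rw [overwrite_of_lt _ _ h, digitSeq_add_mul_of_lt _ _ h, greedySeq_eq c₀ N₀ h]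
    · obtain ⟨n, rfl⟩ := Nat.exists_eq_add_of_le h
      have hn : n < 2 * (c₀ + j) + 1 := by nlinarith
      rw [digitSeq_add_mul_add (greedyCode_lt h₀ j)]
      exact (overwrite_add _ _ u ⟨n, hn⟩).trans (digitSeq_finFunctionFinEquiv u ⟨n, hn⟩).symm
  rw [h1, h2]
  exact potential_digitSeq_le (apply_argminBelow_le
    (fun v => potentialCode b (c₀ + j) (greedyCode b c₀ N₀ j + b ^ (c₀ + j) ^ 2 * v))
    (finFunctionFinEquiv u).2)

theorem exists_computable_poissonGeneric (hb : 2 ≤ b) (w : List (Fin b)) :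
    ∃ x : ℕ → Fin b, Computable x ∧ PoissonGeneric b x ∧
      ∀ i : Fin w.length, x (i : ℕ) = w.get i := by
  have : NeZero b := ⟨by omega⟩
  have hlen : w.length ≤ w.length ^ 2 := Nat.le_self_pow two_ne_zero _
  have h₀ : (finFunctionFinEquiv w.get : ℕ) < b ^ w.length ^ 2 :=
    (finFunctionFinEquiv w.get).2.trans_le (Nat.pow_le_pow_right (by omega) hlen)
  refine ⟨greedySeq b w.length (finFunctionFinEquiv w.get), computable_greedySeq _ _ _,
    (greedy_greedySeq h₀).poissonGeneric hb, fun i => ?_⟩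
  rw [greedySeq_eq (j := 0) _ _ (i.2.trans_le hlen)]
  exact digitSeq_finFunctionFinEquiv w.get i

theorem countable_setOf_computable (b : ℕ) : {x : ℕ → Fin b | Computable x}.Countable := by
  have h : ∀ x : {x : ℕ → Fin b | Computable x},
      ∃ c : Nat.Partrec.Code, c.eval = fun n => Part.some (x.1 n : ℕ) := fun x =>
    Nat.Partrec.Code.exists_code.1
      (Partrec.nat_iff.1 ((Primrec.fin_val.to_comp.comp x.2).partrec))
  choose f hf using h
  refine Set.countable_coe_iff.1 (Function.Injective.countable (f := f) fun x y hxy => ?_)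
  have h := (hf x).symm.trans ((congrArg _ hxy).trans (hf y))
  ext n
  exact Part.some_injective (congrFun h n)

end PoissonGenericity

theorem stmt16 (b : ℕ) (hb : 2 ≤ b) :
    (∃ x : ℕ → Fin b, Computable x ∧ PoissonGeneric b x) ∧
    (∀ w : List (Fin b), ∃ x : ℕ → Fin b, Computable x ∧ PoissonGeneric b x ∧
      ∀ i : Fin w.length, x (i : ℕ) = w.get i) ∧
    {x : ℕ → Fin b | Computable x ∧ PoissonGeneric b x}.Countable ∧
    {x : ℕ → Fin b | Computable x ∧ PoissonGeneric b x}.Infinite ∧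
    Dense {x : ℕ → Fin b | Computable x ∧ PoissonGeneric b x} := by
  have hdense : Dense {x : ℕ → Fin b | Computable x ∧ PoissonGeneric b x} := by
    refine (PiNat.isTopologicalBasis_cylinders fun _ : ℕ => Fin b).dense_iff.2 ?_
    rintro _ ⟨y, n, rfl⟩ -
    obtain ⟨x, hx, hx', hxy⟩ :=
      PoissonGenericity.exists_computable_poissonGeneric hb (List.ofFn fun i : Fin n => y i)
    refine ⟨x, fun i hi => ?_, hx, hx'⟩
    simpa using hxy ⟨i, by simpa using hi⟩
  refine ⟨?_, PoissonGenericity.exists_computable_poissonGeneric hb,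
    (PoissonGenericity.countable_setOf_computable b).mono fun x hx => hx.1, fun hfin => ?_, hdense⟩
  · obtain ⟨x, hx, hx', -⟩ := PoissonGenericity.exists_computable_poissonGeneric hb []
    exact ⟨x, hx, hx'⟩
  · have : Nontrivial (Fin b) := Fin.nontrivial_iff_two_le.2 hb
    have huniv := hfin.isClosed.closure_eq.symm.trans hdense.closure_eq
    rw [huniv] at hfin
    exact Set.infinite_univ hfin
end
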